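/- arXiv:1907.00858 — 8 statements merged into one kernel-verified Lean document; each statement's English description precedes it below -/
import Mathlib

section
/- Let P be a finite poset with maximum element 1̂ and let M be a special partial matching of P. If x, y ∈ P with x < y and M(y) ≤ y, then: (i) M(x) ≤ y; (ii) if M(x) ≤ x then M(x) < M(y); (iii) if M(x) ≥ x then x ≤ M(y). -/
/-- Lifting property of special partial matchings.
Let `P` be a finite poset with maximum element `⊤` and let `M` be a special partial
matching of `P`, i.e. an involution such that `M ⊤ ⋖ ⊤`, every element is moved to a
covered/equal/covering element, and whenever `x ⋖ y` with `M x ≠ y` one has `M x < M y`.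
If `x < y` and `M y ≤ y`, then (i) `M x ≤ y`; (ii) `M x ≤ x → M x < M y`;
(iii) `x ≤ M x → x ≤ M y`. -/
theorem stmt0 {P : Type*} [PartialOrder P] [Fintype P] [OrderTop P] (M : P → P)
    (hinv : Function.Involutive M)
    (htop : M ⊤ ⋖ ⊤)
    (htri : ∀ a : P, M a ⋖ a ∨ M a = a ∨ a ⋖ M a)
    (hspm : ∀ a b : P, a ⋖ b → M a ≠ b → M a < M b)
    {x y : P} (hxy : x < y) (hMy : M y ≤ y) :
    M x ≤ y ∧ (M x ≤ x → M x < M y) ∧ (x ≤ M x → x ≤ M y) := by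
  induction x using WellFoundedGT.induction with
  | ind x ih =>
    obtain ⟨z, hxz, hzy⟩ := exists_covBy_le_of_lt hxy
    rcases hzy.eq_or_lt with rfl | hzy
    · by_cases hM : M x = z
      · have hz : M z = x := by rw [← hM, hinv x]
        exact ⟨hM.le, fun h => absurd (hM ▸ h) hxy.not_ge, fun _ => hz.ge⟩
      · have h := hspm x z hxz hM
        exact ⟨h.le.trans hMy, fun _ => h, fun h' => h'.trans h.le⟩
    · obtain ⟨h₁, h₂, h₃⟩ := ih z hxz.lt hzy
      by_cases hM : M x = z
      · have hz : M z = x := by rw [← hM, hinv x]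
        refine ⟨hM.trans_le hzy.le, fun h => absurd (hM ▸ h) hxz.lt.not_ge, fun _ => ?_⟩
        exact hz ▸ (h₂ (hz.trans_le hxz.le)).le
      · have h := hspm x z hxz hM
        have hz : M z ≤ z ∨ z ≤ M z := by
          rcases htri z with hz | hz | hz
          exacts [.inl hz.le, .inl hz.le, .inr hz.le]
        refine ⟨h.le.trans h₁, fun hx => ?_, fun hx => ?_⟩
        · rcases hz with hz | hz
          · exact h.trans (h₂ hz)
          · exact hx.trans_lt (hxz.lt.trans_le (h₃ hz))
        · rcases hz with hz | hz
          · exact hx.trans (h.trans (h₂ hz)).le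
          · exact hxz.le.trans (h₃ hz)
end

section
/- Every connected pircon P has a minimum element 0̂ and is graded: there is a function ρ : P → ℕ with ρ(0̂) = 0 and ρ(y) = ρ(x) + 1 whenever y covers x. -/
/-- A special partial matching of the order ideal `P_{≤ w}`, encoded as a total function
`M : P → P` whose values outside `Set.Iic w` are irrelevant: `M` maps `Iic w` to itself,
is an involution there, `M w ⋖ w`, every element of `Iic w` is moved to a covered, equal
or covering element, and whenever `x ⋖ y` in `Iic w` with `M x ≠ y` one has `M x < M y`.
(Since `Iic w` is a down-set, covering relations in the subposet `P_{≤ w}` agree with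
covering relations in `P`.) -/
def IsSPMof {P : Type*} [PartialOrder P] (w : P) (M : P → P) : Prop :=
  (∀ x, x ≤ w → M x ≤ w) ∧ (∀ x, x ≤ w → M (M x) = x) ∧ M w ⋖ w ∧
  (∀ x, x ≤ w → (M x ⋖ x ∨ M x = x ∨ x ⋖ M x)) ∧
  (∀ x y, x ≤ w → y ≤ w → x ⋖ y → M x ≠ y → M x < M y)

/-- A poset is a pircon if, for every non-minimal element `w`, the order ideal `P_{≤ w}`
is finite and admits a special partial matching. -/
def IsPircon (P : Type*) [PartialOrder P] : Prop :=
  ∀ w : P, ¬ IsMin w → (Set.Iic w).Finite ∧ ∃ M : P → P, IsSPMof w M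

theorem IsPircon.finite_Iic {P : Type*} [PartialOrder P] (hP : IsPircon P) (w : P) :
    (Set.Iic w).Finite := by
  by_cases h : IsMin w
  · rw [h.Iic_eq]
    exact Set.finite_singleton w
  · exact (hP w h).1

theorem IsPircon.wellFoundedLT {P : Type*} [PartialOrder P] (hP : IsPircon P) :
    WellFoundedLT P :=
  StrictMono.wellFoundedLT (f := fun w : P => (Set.Iic w).ncard) fun _ y h =>
    Set.ncard_lt_ncard (Set.Iic_ssubset_Iic.2 h) (hP.finite_Iic y)

theorem IsPircon.exists_le_covBy {P : Type*} [PartialOrder P] (hP : IsPircon P) {z w : P}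
    (h : z < w) : ∃ c, z ≤ c ∧ c ⋖ w := by
  obtain ⟨c, hzc, hc⟩ :=
    ((hP.finite_Iic w).subset Set.Iio_subset_Iic_self).exists_le_maximal (Set.mem_Iio.2 h)
  exact ⟨c, hzc, hc.prop, fun d hcd hdw => hcd.not_ge (hc.le_of_ge hdw hcd.le)⟩

theorem IsPircon.exists_covBy_le {P : Type*} [PartialOrder P] (hP : IsPircon P) {z w : P}
    (h : z < w) : ∃ c, z ⋖ c ∧ c ≤ w := by
  obtain ⟨c, hcw, hc⟩ := ((hP.finite_Iic w).subset Set.Ioc_subset_Iic_self).exists_le_minimal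
    (Set.right_mem_Ioc.2 h)
  exact ⟨c, ⟨hc.prop.1, fun d hzd hdc =>
    hdc.not_ge (hc.le_of_le ⟨hzd, hdc.le.trans hcw⟩ hdc.le)⟩, hcw⟩

/-- If `c` is a coatom of `Iic w` other than `M w`, then `M c` is a common lower cover of `c`
and `M w`. -/
theorem IsPircon.covBy_of_covBy {P : Type*} [PartialOrder P] (hP : IsPircon P)
    {w c : P} {M : P → P} (hM : IsSPMof w M) (hc : c ⋖ w) (hne : c ≠ M w) : M c ⋖ c ∧ M c ⋖ M w := by
  obtain ⟨hle, hinv, hw, hadj, hlt⟩ := hM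
  have hcw := hc.le
  have hMc : M c < M w := hlt c w hcw le_rfl hc fun h => hne <| by rw [← h, hinv c hcw]
  have hnot : ¬ c ≤ M w := fun h => hc.2 (lt_of_le_of_ne h hne) hw.lt
  have hMcc : M c ⋖ c := by
    rcases hadj c hcw with h | h | h
    · exact h
    · exact absurd (h ▸ hMc.le) hnot
    · exact absurd (h.le.trans hMc.le) hnot
  obtain ⟨z, hz, hzm⟩ := hP.exists_covBy_le hMc
  have hzw := hzm.trans hw.le
  have hcz : M (M c) < M z := hlt (M c) z (hle c hcw) hzw hz fun h =>
    hnot (by rwa [← h, hinv c hcw] at hzm)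
  rw [hinv c hcw] at hcz
  have hMz : M z = w := (hle z hzw).eq_of_not_lt fun h => hc.2 hcz h
  rw [← hMz, hinv z hzw]
  exact ⟨hMcc, hz⟩

theorem IsPircon.exists_isLeast_Iic {P : Type*} [PartialOrder P] (hP : IsPircon P) (w : P) :
    ∃ b, IsLeast (Set.Iic w) b := by
  have := hP.wellFoundedLT
  induction w using WellFoundedLT.induction with
  | ind w ih =>
  by_cases hmin : IsMin w
  · exact ⟨w, le_rfl, fun z hz => hmin hz⟩
  obtain ⟨-, M, hM⟩ := hP w hmin
  have hw : M w ⋖ w := hM.2.2.1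
  obtain ⟨b, hb, hbl⟩ := ih _ hw.lt
  refine ⟨b, hb.trans hw.le, fun z hz => ?_⟩
  rcases (Set.mem_Iic.1 hz).eq_or_lt with rfl | hz
  · exact hb.trans hw.le
  obtain ⟨c, hzc, hc⟩ := hP.exists_le_covBy hz
  by_cases hne : c = M w
  · exact hbl (hne ▸ hzc)
  obtain ⟨h₁, h₂⟩ := hP.covBy_of_covBy hM hc hne
  obtain ⟨b', -, hbl'⟩ := ih _ hc.lt
  exact (hbl ((hbl' h₁.le).trans h₂.le)).trans (hbl' hzc)

theorem IsPircon.height_eq_add_one {P : Type*} [PartialOrder P] (hP : IsPircon P) {x y : P}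
    (hxy : x ⋖ y) : Order.height y = Order.height x + 1 := by
  have := hP.wellFoundedLT
  induction y using WellFoundedLT.induction generalizing x with
  | ind w ih =>
  obtain ⟨-, M, hM⟩ := hP w hxy.lt.not_isMin
  have hw : M w ⋖ w := hM.2.2.1
  have key : ∀ c, c ⋖ w → Order.height c = Order.height (M w) := fun c hc => by
    by_cases hne : c = M w
    · rw [hne]
    obtain ⟨h₁, h₂⟩ := hP.covBy_of_covBy hM hc hne
    rw [ih c hc.lt h₁, ih _ hw.lt h₂]
  refine le_antisymm ?_ (Order.height_add_one_le hxy.lt)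
  rw [Order.height_eq_iSup_lt_height]
  refine iSup₂_le fun z hz => ?_
  obtain ⟨c, hzc, hc⟩ := hP.exists_le_covBy hz
  rw [key x hxy, ← key c hc]
  gcongr

theorem IsPircon.height_ne_top {P : Type*} [PartialOrder P] (hP : IsPircon P) (w : P) :
    Order.height w ≠ ⊤ := by
  have := hP.wellFoundedLT
  induction w using WellFoundedLT.induction with
  | ind w ih =>
  by_cases hmin : IsMin w
  · simp [Order.height_eq_zero.2 hmin]
  obtain ⟨-, M, hM⟩ := hP w hmin
  have hw : M w ⋖ w := hM.2.2.1
  rw [hP.height_eq_add_one hw]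
  simpa using ih _ hw.lt

/-- Every connected pircon `P` (connectedness of the comparability
graph) has a minimum element `0̂` and is graded: there is `ρ : P → ℕ` with `ρ 0̂ = 0` and
`ρ y = ρ x + 1` whenever `y` covers `x`. -/
theorem stmt1 {P : Type*} [PartialOrder P] [Nonempty P] (hP : IsPircon P)
    (hconn : ∀ a b : P, Relation.ReflTransGen (fun x y : P => x ≤ y ∨ y ≤ x) a b) :
    ∃ bot : P, (∀ z : P, bot ≤ z) ∧
      ∃ ρ : P → ℕ, ρ bot = 0 ∧ ∀ x y : P, x ⋖ y → ρ y = ρ x + 1 := by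
  obtain ⟨a⟩ := ‹Nonempty P›
  obtain ⟨b, hba, hb⟩ := hP.exists_isLeast_Iic a
  have hbot : ∀ z, b ≤ z := fun z => by
    induction hconn a z with
    | refl => exact hba
    | @tail x y _ hxy ih =>
      rcases hxy with hxy | hyx
      · exact ih.trans hxy
      · obtain ⟨b', -, hb'⟩ := hP.exists_isLeast_Iic x
        exact (hb ((hb' ih).trans hba)).trans (hb' hyx)
  refine ⟨b, hbot, fun x => (Order.height x).toNat, ?_, fun x y hxy => ?_⟩
  · simp [Order.height_eq_zero.2 fun z _ => hbot z]
  · simp only [hP.height_eq_add_one hxy]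
    rw [ENat.toNat_add (hP.height_ne_top x) (by simp), ENat.toNat_one]
end

section
/- Let M be a special partial matching of a finite poset P with maximum, and let x, y ∈ P with x ≤ y, M(y) ≤ y and M(x) ≥ x. Then M maps the interval [x,y] = {z ∈ P : x ≤ z ≤ y} into itself, so M restricts to a partial matching of [x,y]; moreover, this restriction is a special partial matching of the poset [x,y] if and only if M(y) is covered by y. -/
/-- `a` is covered by `b` inside the subposet induced on the set `O`. -/
def CovIn {P : Type*} [PartialOrder P] (O : Set P) (a b : P) : Prop :=
  a ∈ O ∧ b ∈ O ∧ a < b ∧ ∀ c ∈ O, ¬ (a < c ∧ c < b)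

theorem covIn_Icc_iff {P : Type*} [PartialOrder P] {x y a b : P} :
    CovIn (Set.Icc x y) a b ↔ a ∈ Set.Icc x y ∧ b ∈ Set.Icc x y ∧ a ⋖ b := by
  constructor
  · rintro ⟨ha, hb, hab, h⟩
    exact ⟨ha, hb, hab, fun c hac hcb =>
      h c ⟨ha.1.trans hac.le, hcb.le.trans hb.2⟩ ⟨hac, hcb⟩⟩
  · rintro ⟨ha, hb, hab⟩
    exact ⟨ha, hb, hab.lt, fun c _ hc => hab.2 hc.1 hc.2⟩

/-- The lifting property: if `M y ≤ y`, then `M` preserves the lower set of `y`. -/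
theorem matching_le_of_le {P : Type*} [PartialOrder P] [Finite P] {M : P → P}
    (hspm : ∀ a b : P, a ⋖ b → M a ≠ b → M a < M b)
    {y : P} (hMy : M y ≤ y) (z : P) (hz : z ≤ y) : M z ≤ y := by
  induction z using WellFoundedGT.induction with
  | ind z ih =>
    rcases hz.eq_or_lt with rfl | hlt
    · exact hMy
    obtain ⟨c, hzc, hcy⟩ := exists_covBy_le_of_lt hlt
    by_cases hc : M z = c
    · exact hc.trans_le hcy
    · exact (hspm z c hzc hc).le.trans (ih c hzc.lt hcy)

/-- The dual lifting property: if `x ≤ M x`, then `M` preserves the upper set of `x`. -/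
theorem le_matching_of_le {P : Type*} [PartialOrder P] [Finite P] {M : P → P}
    (hinv : Function.Involutive M)
    (hspm : ∀ a b : P, a ⋖ b → M a ≠ b → M a < M b)
    {x : P} (hMx : x ≤ M x) (z : P) (hz : x ≤ z) : x ≤ M z := by
  induction z using WellFoundedLT.induction with
  | ind z ih =>
    rcases hz.eq_or_lt with rfl | hlt
    · exact hMx
    obtain ⟨c, hxc, hcz⟩ := exists_le_covBy_of_lt hlt
    by_cases hc : M c = z
    · rwa [← hc, hinv c]
    · exact (ih c hcz.lt hxc).trans (hspm c z hcz hc).le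

/-- Let `M` be a special partial matching of a finite poset `P` with
maximum, and let `x ≤ y` with `M y ≤ y` and `x ≤ M x`.  Then `M` maps the interval
`[x,y]` into itself, the restriction is a partial matching of `[x,y]` (an involution
moving each element to a covered, equal or covering element of the subposet `[x,y]`),
and this restriction is a special partial matching of the poset `[x,y]` (with top `y`)
if and only if `M y` is covered by `y`. -/
theorem stmt2 {P : Type*} [PartialOrder P] [Fintype P] [OrderTop P] (M : P → P)
    (hinv : Function.Involutive M)
    (htop : M ⊤ ⋖ ⊤)
    (htri : ∀ a : P, M a ⋖ a ∨ M a = a ∨ a ⋖ M a)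
    (hspm : ∀ a b : P, a ⋖ b → M a ≠ b → M a < M b)
    (x y : P) (hxy : x ≤ y) (hMy : M y ≤ y) (hMx : x ≤ M x) :
    (∀ z ∈ Set.Icc x y, M z ∈ Set.Icc x y) ∧
    (∀ z ∈ Set.Icc x y, M (M z) = z) ∧
    (∀ z ∈ Set.Icc x y,
      CovIn (Set.Icc x y) (M z) z ∨ M z = z ∨ CovIn (Set.Icc x y) z (M z)) ∧
    ((CovIn (Set.Icc x y) (M y) y ∧
      ∀ a ∈ Set.Icc x y, ∀ b ∈ Set.Icc x y,
        CovIn (Set.Icc x y) a b → M a ≠ b → M a < M b) ↔ M y ⋖ y) := by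
  have hmaps : ∀ z ∈ Set.Icc x y, M z ∈ Set.Icc x y := fun z hz =>
    ⟨le_matching_of_le hinv hspm hMx z hz.1, matching_le_of_le hspm hMy z hz.2⟩
  have hy : y ∈ Set.Icc x y := ⟨hxy, le_rfl⟩
  refine ⟨hmaps, fun z _ => hinv z, fun z hz => ?_, fun h => (covIn_Icc_iff.1 h.1).2.2,
    fun h => ⟨covIn_Icc_iff.2 ⟨hmaps y hy, hy, h⟩, fun a _ b _ hab =>
      hspm a b (covIn_Icc_iff.1 hab).2.2⟩⟩
  rcases htri z with h | h | h
  · exact .inl (covIn_Icc_iff.2 ⟨hmaps z hz, hz, h⟩)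
  · exact .inr (.inl h)
  · exact .inr (.inr (covIn_Icc_iff.2 ⟨hz, hmaps z hz, h⟩))
end

section
/- Let P be a pircon, w ∈ P a non-minimal element, and M, N ∈ SPM_w two special partial matchings of w. Then every orbit of the group ⟨M,N⟩ acting on P_{≤w} is either dihedral or chain-like. -/
/-- The orbit of `u` under the group of permutations generated by the two involutions
`M` and `N`: the set of elements reachable from `u` by applying `M` and `N`. -/
def orbitMN {P : Type*} (M N : P → P) (u : P) : Set P :=
  {v | Relation.ReflTransGen (fun a b => M a = b ∨ N a = b) u v}

/-- The set `O`, with the induced order, is a dihedral interval of rank `n`: a finite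
poset with a minimum and a maximum, graded of rank `n`, having exactly two elements of
each rank `i` with `0 < i < n`, and with `x < y` whenever `ρ x < ρ y`. -/
def IsDihedralIntervalOfRank {P : Type*} [PartialOrder P] (O : Set P) (n : ℕ) : Prop :=
  O.Finite ∧ ∃ ρ : P → ℕ,
    (∃ b ∈ O, (∀ z ∈ O, b ≤ z) ∧ ρ b = 0) ∧
    (∃ t ∈ O, (∀ z ∈ O, z ≤ t) ∧ ρ t = n) ∧
    (∀ a b, CovIn O a b → ρ b = ρ a + 1) ∧
    (∀ i, 0 < i → i < n → {z ∈ O | ρ z = i}.ncard = 2) ∧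
    (∀ a ∈ O, ∀ b ∈ O, ρ a < ρ b → a < b)

/-- An orbit `O` of `⟨M,N⟩` is dihedral if it is a dihedral interval (of some rank) and
no element of `O` is fixed by `M` or by `N`. -/
def IsDihedralOrbit {P : Type*} [PartialOrder P] (M N : P → P) (O : Set P) : Prop :=
  (∃ n, IsDihedralIntervalOfRank O n) ∧ ∀ u ∈ O, M u ≠ u ∧ N u ≠ u

/-- An orbit `O` of `⟨M,N⟩` is chain-like if it is totally ordered, its minimum is fixed
by `M` or by `N`, and its maximum is fixed by `M` or by `N`. -/
def IsChainLikeOrbit {P : Type*} [PartialOrder P] (M N : P → P) (O : Set P) : Prop :=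
  (∀ a ∈ O, ∀ b ∈ O, a ≤ b ∨ b ≤ a) ∧
  (∃ b ∈ O, (∀ z ∈ O, b ≤ z) ∧ (M b = b ∨ N b = b)) ∧
  (∃ t ∈ O, (∀ z ∈ O, z ≤ t) ∧ (M t = t ∨ N t = t))

/-- A partial matching of a whole poset satisfying the conditions of a special partial matching,
except the one on the maximum. Unlike `IsSPMof`, this notion is self-dual. -/
structure IsPartialMatching {Q : Type*} [PartialOrder Q] (M : Q → Q) : Prop where
  involutive : Function.Involutive M
  covBy_or_eq : ∀ x, M x ⋖ x ∨ M x = x ∨ x ⋖ M x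
  map_lt : ∀ x y, x ⋖ y → M x ≠ y → M x < M y

/-- Apply `M` and `N` alternately, `r` times in total, to `x`, starting with `M`. -/
def zigzag {Q : Type*} (M N : Q → Q) (x : Q) : ℕ → Q
  | 0 => x
  | r + 1 => (if Even r then M else N) (zigzag M N x r)

section Orbit

variable {Q : Type*} {M N : Q → Q}

theorem orbitMN_comm (M N : Q → Q) (u : Q) : orbitMN M N u = orbitMN N M u := by
  simp only [orbitMN, or_comm]

theorem mem_orbitMN_self (M N : Q → Q) (u : Q) : u ∈ orbitMN M N u := Relation.ReflTransGen.refl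

theorem map_left_mem_orbitMN {u v : Q} (h : v ∈ orbitMN M N u) : M v ∈ orbitMN M N u :=
  Relation.ReflTransGen.tail h (Or.inl rfl)

theorem map_right_mem_orbitMN {u v : Q} (h : v ∈ orbitMN M N u) : N v ∈ orbitMN M N u :=
  Relation.ReflTransGen.tail h (Or.inr rfl)

theorem orbitMN_subset {u : Q} {A : Set Q} (hu : u ∈ A) (hA : ∀ x ∈ A, M x ∈ A ∧ N x ∈ A) :
    orbitMN M N u ⊆ A := by
  intro v hv
  induction hv with
  | refl => exact hu
  | tail _ hbc ih =>
    rcases hbc with rfl | rfl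
    · exact (hA _ ih).1
    · exact (hA _ ih).2

theorem orbitMN_eq_of_mem (hM : Function.Involutive M) (hN : Function.Involutive N) {u v : Q}
    (h : v ∈ orbitMN M N u) : orbitMN M N v = orbitMN M N u := by
  have : Std.Symm (fun a b => M a = b ∨ N a = b) := by
    refine ⟨?_⟩
    rintro a b (rfl | rfl)
    · exact Or.inl (hM a)
    · exact Or.inr (hN a)
  ext z
  exact ⟨fun hz => Relation.ReflTransGen.trans h hz,
    fun hz => Relation.ReflTransGen.trans (Relation.ReflTransGen.stdSymm.symm _ _ h) hz⟩

theorem zigzag_mem_orbitMN (M N : Q → Q) (u : Q) (r : ℕ) : zigzag M N u r ∈ orbitMN M N u := by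
  induction r with
  | zero => exact mem_orbitMN_self M N u
  | succ r ih =>
    rw [zigzag]
    split_ifs
    · exact map_left_mem_orbitMN ih
    · exact map_right_mem_orbitMN ih

theorem zigzag_succ_of_even {x : Q} {r : ℕ} (hr : Even r) :
    zigzag M N x (r + 1) = M (zigzag M N x r) := by
  rw [zigzag, if_pos hr]

theorem zigzag_succ_of_not_even {x : Q} {r : ℕ} (hr : ¬ Even r) :
    zigzag M N x (r + 1) = N (zigzag M N x r) := by
  rw [zigzag, if_neg hr]

end Orbit

/-- Two descending sequences `a` and `b` of length `n` with common endpoints, and otherwise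
disjoint, form a dihedral interval if each step also goes down from one sequence to the other. -/
structure IsLadder {Q : Type*} [PartialOrder Q] (a b : ℕ → Q) (n : ℕ) : Prop where
  zero : a 0 = b 0
  last : a n = b n
  ne : ∀ r, 0 < r → r < n → a r ≠ b r
  left : ∀ r < n, a (r + 1) ⋖ a r
  right : ∀ r < n, b (r + 1) ⋖ b r
  left_right : ∀ r < n, a (r + 1) < b r
  right_left : ∀ r < n, b (r + 1) < a r

namespace IsLadder

variable {Q : Type*} [PartialOrder Q] {a b : ℕ → Q} {n : ℕ}

theorem symm (h : IsLadder a b n) : IsLadder b a n :=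
  ⟨h.zero.symm, h.last.symm, fun r h0 hn => (h.ne r h0 hn).symm, h.right, h.left, h.right_left,
    h.left_right⟩

theorem left_lt (h : IsLadder a b n) {r s : ℕ} (hrs : r < s) (hs : s ≤ n) :
    a s < a r ∧ a s < b r := by
  induction s, hrs using Nat.le_induction with
  | base => exact ⟨(h.left r hs).lt, h.left_right r hs⟩
  | succ s hrs ih =>
    have := ih (by omega)
    exact ⟨(h.left s hs).lt.trans this.1, (h.left s hs).lt.trans this.2⟩

theorem not_left_lt_right (h : IsLadder a b n) {r : ℕ} (hr : r ≤ n) : ¬ a r < b r := by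
  intro hlt
  rcases r with _ | r
  · exact hlt.ne h.zero
  · exact (h.left r hr).2 hlt (h.right_left r hr)

/-- The elements of a ladder. -/
def carrier (a b : ℕ → Q) (n : ℕ) : Set Q := {z | ∃ r ≤ n, z = a r ∨ z = b r}

theorem carrier_comm {Q : Type*} (a b : ℕ → Q) (n : ℕ) : carrier a b n = carrier b a n := by
  simp only [carrier, or_comm]

theorem lt_of_lt (h : IsLadder a b n) {x y : Q} {r s : ℕ} (hx : x = a r ∨ x = b r)
    (hy : y = a s ∨ y = b s) (hrs : r < s) (hs : s ≤ n) : y < x := by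
  have h1 := h.left_lt hrs hs
  have h2 := h.symm.left_lt hrs hs
  rcases hx with rfl | rfl <;> rcases hy with rfl | rfl
  exacts [h1.1, h2.2, h1.2, h2.1]

theorem not_lt_of_eq (h : IsLadder a b n) {x y : Q} {r : ℕ} (hx : x = a r ∨ x = b r)
    (hy : y = a r ∨ y = b r) (hr : r ≤ n) : ¬ x < y := by
  rcases hx with rfl | rfl <;> rcases hy with rfl | rfl
  exacts [lt_irrefl _, h.not_left_lt_right hr, h.symm.not_left_lt_right hr, lt_irrefl _]

theorem lt_iff (h : IsLadder a b n) {x y : Q} {r s : ℕ} (hx : x = a r ∨ x = b r)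
    (hy : y = a s ∨ y = b s) (hr : r ≤ n) (hs : s ≤ n) : y < x ↔ r < s := by
  refine ⟨fun hlt => ?_, fun hrs => h.lt_of_lt hx hy hrs hs⟩
  by_contra hrs
  rcases (not_lt.1 hrs).lt_or_eq with hsr | rfl
  · exact lt_asymm hlt (h.lt_of_lt hy hx hsr hr)
  · exact h.not_lt_of_eq hy hx hr hlt

theorem isDihedralInterval (h : IsLadder a b n) :
    IsDihedralIntervalOfRank (carrier a b n) n := by
  have ha : ∀ r ≤ n, a r ∈ carrier a b n := fun r hr => ⟨r, hr, Or.inl rfl⟩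
  have hb : ∀ r ≤ n, b r ∈ carrier a b n := fun r hr => ⟨r, hr, Or.inr rfl⟩
  have hex : ∀ z, ∃ k, z ∈ carrier a b n → k ≤ n ∧ (z = a (n - k) ∨ z = b (n - k)) := by
    intro z
    by_cases hz : z ∈ carrier a b n
    · obtain ⟨r, hr, hz⟩ := hz
      refine ⟨n - r, fun _ => ⟨by omega, ?_⟩⟩
      rwa [Nat.sub_sub_self hr]
    · exact ⟨0, fun h => absurd h hz⟩
  choose ρ hρ using hex
  have lt_iff_rank : ∀ x ∈ carrier a b n, ∀ y ∈ carrier a b n, x < y ↔ ρ x < ρ y := by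
    intro x hx y hy
    obtain ⟨hxn, hx⟩ := hρ x hx
    obtain ⟨hyn, hy⟩ := hρ y hy
    rw [h.lt_iff hy hx (Nat.sub_le _ _) (Nat.sub_le _ _)]
    omega
  have rank_eq : ∀ x r, r ≤ n → (x = a r ∨ x = b r) → ρ x = n - r := by
    intro x r hr hx
    obtain ⟨hxn, hx'⟩ := hρ x ⟨r, hr, hx⟩
    have h1 := h.lt_iff hx hx' hr (Nat.sub_le _ _)
    have h2 := h.lt_iff hx' hx (Nat.sub_le _ _) hr
    simp only [lt_irrefl, false_iff] at h1 h2
    omega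
  refine ⟨?_, ρ, ⟨a n, ha n le_rfl, ?_, ?_⟩, ⟨a 0, ha 0 (Nat.zero_le _), ?_, ?_⟩, ?_, ?_, ?_⟩
  · refine (((Set.finite_Iic n).image a).union ((Set.finite_Iic n).image b)).subset ?_
    rintro z ⟨r, hr, rfl | rfl⟩
    · exact Or.inl ⟨r, hr, rfl⟩
    · exact Or.inr ⟨r, hr, rfl⟩
  · rintro z ⟨r, hr, hz⟩
    rcases hr.lt_or_eq with hr | rfl
    · exact (h.lt_of_lt hz (Or.inl rfl) hr le_rfl).le
    · rcases hz with rfl | rfl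
      exacts [le_rfl, h.last.le]
  · rw [rank_eq _ n le_rfl (Or.inl rfl), Nat.sub_self]
  · rintro z ⟨r, hr, hz⟩
    rcases r.eq_zero_or_pos with rfl | h0
    · rcases hz with rfl | rfl
      exacts [le_rfl, h.zero.ge]
    · exact (h.lt_of_lt (Or.inl rfl) hz h0 hr).le
  · rw [rank_eq _ 0 (Nat.zero_le _) (Or.inl rfl), Nat.sub_zero]
  · rintro x y ⟨hx, hy, hxy, hcov⟩
    have h1 := (lt_iff_rank x hx y hy).1 hxy
    by_contra hne
    have hyn := (hρ y hy).1
    have hz := ha (n - (ρ x + 1)) (Nat.sub_le _ _)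
    have hzr := rank_eq _ (n - (ρ x + 1)) (Nat.sub_le _ _) (Or.inl rfl)
    refine hcov _ hz ⟨(lt_iff_rank _ hx _ hz).2 ?_, (lt_iff_rank _ hz _ hy).2 ?_⟩ <;> omega
  · intro i h0 hi
    rw [← Set.ncard_pair (h.ne (n - i) (by omega) (by omega))]
    congr 1
    ext z
    simp only [Set.mem_ofPred_eq, Set.mem_insert_iff, Set.mem_singleton_iff]
    constructor
    · rintro ⟨hz, rfl⟩
      exact (hρ z hz).2
    · intro hz
      refine ⟨⟨n - i, Nat.sub_le _ _, hz⟩, ?_⟩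
      rw [rank_eq z (n - i) (Nat.sub_le _ _) hz]
      omega
  · exact fun x hx y hy => (lt_iff_rank x hx y hy).2

end IsLadder

namespace IsPartialMatching

variable {Q : Type*} [PartialOrder Q] {M N : Q → Q}

theorem dual (hM : IsPartialMatching M) : IsPartialMatching (Q := Qᵒᵈ) M where
  involutive := hM.involutive
  covBy_or_eq x := by
    rcases hM.covBy_or_eq x with h | h | h
    exacts [Or.inr (Or.inr h.toDual), Or.inr (Or.inl h), Or.inl h.toDual]
  map_lt x y hxy hne :=
    hM.map_lt y x hxy.ofDual fun h => hne ((congrArg M h).symm.trans (hM.involutive y))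

/-- The lifting property. -/
theorem lifting [Finite Q] (hM : IsPartialMatching M) {x y : Q} (hxy : x ≤ y) :
    M x ≤ M y ∨ (M x ≤ y ∧ x ≤ M y) := by
  classical
  have := Fintype.ofFinite Q
  let _ : DecidableLE Q := Classical.decRel _
  let _ : LocallyFiniteOrder Q := Fintype.toLocallyFiniteOrder
  have hc := le_iff_reflTransGen_covBy.1 hxy
  clear hxy
  induction hc using Relation.ReflTransGen.head_induction_on with
  | refl => exact Or.inl le_rfl
  | @head x z hxz hzy ih =>
    have hzy := le_iff_reflTransGen_covBy.2 hzy
    by_cases hne : M x = z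
    · have hz : M z = x := hne ▸ hM.involutive x
      rw [hz] at ih
      exact Or.inr ⟨hne.trans_le hzy, ih.elim id fun h => hxz.le.trans h.2⟩
    · have hlt := hM.map_lt x z hxz hne
      exact ih.imp hlt.le.trans fun h => ⟨hlt.le.trans h.1, hxz.le.trans h.2⟩

theorem covBy_of_lt (hM : IsPartialMatching M) {x : Q} (h : ¬ x ≤ M x) : M x ⋖ x := by
  rcases hM.covBy_or_eq x with h' | h' | h'
  exacts [h', absurd h'.ge h, absurd h'.le h]

theorem covBy_or_eq_of_maximal (hM : IsPartialMatching M) {O : Set Q} {t : Q}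
    (ht : Maximal (· ∈ O) t)
    (h : M t ∈ O) : M t ⋖ t ∨ M t = t := by
  rcases hM.covBy_or_eq t with h' | h' | h'
  exacts [Or.inl h', Or.inr h', absurd h'.lt (ht.not_gt h)]

theorem covBy_or_eq_of_minimal (hM : IsPartialMatching M) {O : Set Q} {t : Q}
    (ht : Minimal (· ∈ O) t)
    (h : M t ∈ O) : t ⋖ M t ∨ M t = t := by
  rcases hM.covBy_or_eq t with h' | h' | h'
  exacts [absurd h'.lt (ht.not_lt h), Or.inr h', Or.inl h']

/-- If `z` covers `x` and lies above `T y ≠ x`, where `x < y`, then `T x` is covered by `x` and lies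
below `T y`. -/
theorem ladder_step [Finite Q] {T : Q → Q} (hT : IsPartialMatching T) {x y z : Q} (hxz : x ⋖ z)
    (hxy : x < y) (hyz : T y < z) (hne : x ≠ T y) : T x ⋖ x ∧ T x < T y := by
  have hnle : ¬ x ≤ T y := fun hle => hxz.2 (hle.lt_of_ne hne) hyz
  have hle : T x ≤ T y := (hT.lifting hxy.le).resolve_right fun h => hnle h.2
  exact ⟨hT.covBy_of_lt fun h => hnle (h.trans hle),
    hle.lt_of_ne fun h => hxy.ne (hT.involutive.injective h)⟩

theorem zigzag_ladder_step [Finite Q] (hM : IsPartialMatching M) (hN : IsPartialMatching N) {t : Q}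
    {r : ℕ} (h1 : zigzag M N t (r + 1) ⋖ zigzag M N t r)
    (h2 : zigzag M N t (r + 1) < zigzag N M t r) (h3 : zigzag N M t (r + 1) < zigzag M N t r)
    (hne : zigzag M N t (r + 1) ≠ zigzag N M t (r + 1)) :
    zigzag M N t (r + 2) ⋖ zigzag M N t (r + 1) ∧
      zigzag M N t (r + 2) < zigzag N M t (r + 1) := by
  by_cases hr : Even r
  · have e1 : zigzag M N t (r + 2) = N (zigzag M N t (r + 1)) :=
      zigzag_succ_of_not_even (by simpa [Nat.even_add_one] using hr)
    rw [e1, zigzag_succ_of_even (M := N) hr] at *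
    exact hN.ladder_step h1 h2 h3 hne
  · have e1 : zigzag M N t (r + 2) = M (zigzag M N t (r + 1)) :=
      zigzag_succ_of_even (by simpa [Nat.even_add_one] using hr)
    rw [e1, zigzag_succ_of_not_even (M := N) hr] at *
    exact hM.ladder_step h1 h2 h3 hne

theorem exists_isLadder [Finite Q] (hM : IsPartialMatching M) (hN : IsPartialMatching N) {t : Q}
    (h1 : M t ⋖ t) (h2 : N t ⋖ t) :
    ∃ n, 0 < n ∧ IsLadder (zigzag M N t) (zigzag N M t) n := by
  classical
  set a := zigzag M N t with ha
  set b := zigzag N M t with hb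
  have steps : ∀ r, (∀ s, 0 < s → s ≤ r → a s ≠ b s) →
      (a (r + 1) ⋖ a r ∧ a (r + 1) < b r) ∧ b (r + 1) ⋖ b r ∧ b (r + 1) < a r := by
    intro r
    induction r with
    | zero => exact fun _ => ⟨⟨h1, h1.lt⟩, h2, h2.lt⟩
    | succ r ih =>
      intro hne
      obtain ⟨⟨i1, i2⟩, i3, i4⟩ := ih fun s h0 hs => hne s h0 (by omega)
      have hr := hne (r + 1) (by omega) le_rfl
      exact ⟨zigzag_ladder_step hM hN i1 i2 i4 hr, zigzag_ladder_step hN hM i3 i4 i2 hr.symm⟩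
  have hex : ∃ n, 0 < n ∧ a n = b n := by
    by_contra! hcon
    have : StrictAnti a := strictAnti_nat_of_succ_lt fun r =>
      (steps r fun s h0 _ => hcon s h0).1.1.lt
    exact not_injective_infinite_finite a this.injective
  have hmin : ∀ r, 0 < r → r < Nat.find hex → a r ≠ b r := fun r h0 hr he =>
    Nat.find_min hex hr ⟨h0, he⟩
  have steps' := fun r (hr : r < Nat.find hex) =>
    steps r fun s h0 hs => hmin s h0 (hs.trans_lt hr)
  exact ⟨Nat.find hex, (Nat.find_spec hex).1, rfl, (Nat.find_spec hex).2, hmin,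
    fun r hr => (steps' r hr).1.1, fun r hr => (steps' r hr).2.1,
    fun r hr => (steps' r hr).1.2, fun r hr => (steps' r hr).2.2⟩

theorem map_zigzag_mem_carrier (hM : Function.Involutive M) (hN : Function.Involutive N) {t : Q}
    {n : ℕ} (h0 : 0 < n) (h : IsLadder (zigzag M N t) (zigzag N M t) n) {r : ℕ} (hr : r ≤ n) :
    (M (zigzag M N t r) ∈ IsLadder.carrier (zigzag M N t) (zigzag N M t) n ∧
      M (zigzag M N t r) ≠ zigzag M N t r) ∧
    (N (zigzag M N t r) ∈ IsLadder.carrier (zigzag M N t) (zigzag N M t) n ∧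
      N (zigzag M N t r) ≠ zigzag M N t r) := by
  have fwd : ∀ T : Q → Q, r < n → zigzag M N t (r + 1) = T (zigzag M N t r) →
      T (zigzag M N t r) ∈ IsLadder.carrier (zigzag M N t) (zigzag N M t) n ∧
        T (zigzag M N t r) ≠ zigzag M N t r := fun T hrn e =>
    ⟨⟨r + 1, hrn, Or.inl e.symm⟩, e ▸ (h.left r hrn).lt.ne⟩
  have bwd : ∀ (T : Q → Q) (s : ℕ), Function.Involutive T → r = s + 1 →
      zigzag M N t (s + 1) = T (zigzag M N t s) →
      T (zigzag M N t r) ∈ IsLadder.carrier (zigzag M N t) (zigzag N M t) n ∧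
        T (zigzag M N t r) ≠ zigzag M N t r := by
    rintro T s hT rfl e
    have e' : T (zigzag M N t (s + 1)) = zigzag M N t s := by rw [e, hT]
    rw [e']
    exact ⟨⟨s, by omega, Or.inl rfl⟩, (h.left s hr).lt.ne'⟩
  have turn : ∀ (T : Q → Q) (s : ℕ), Function.Involutive T → r = s + 1 → r = n →
      zigzag N M t (s + 1) = T (zigzag N M t s) →
      T (zigzag M N t r) ∈ IsLadder.carrier (zigzag M N t) (zigzag N M t) n ∧
        T (zigzag M N t r) ≠ zigzag M N t r := by
    rintro T s hT rfl rfl e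
    have e' : T (zigzag M N t (s + 1)) = zigzag N M t s := by rw [h.last, e, hT]
    rw [e']
    exact ⟨⟨s, by omega, Or.inr rfl⟩, (h.left_right s (by omega)).ne'⟩
  rcases r with _ | s
  · exact ⟨fwd M h0 rfl, ⟨1, h0, Or.inr rfl⟩, (h.right 0 h0).lt.ne⟩
  by_cases hs : Even s
  · have hs' : ¬ Even (s + 1) := by simpa [Nat.even_add_one] using hs
    refine ⟨bwd M s hM rfl (zigzag_succ_of_even hs), ?_⟩
    rcases hr.lt_or_eq with hrn | hrn
    · exact fwd N hrn (zigzag_succ_of_not_even hs')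
    · exact turn N s hN rfl hrn (zigzag_succ_of_even hs)
  · have hs' : Even (s + 1) := by simpa [Nat.even_add_one] using hs
    refine ⟨?_, bwd N s hN rfl (zigzag_succ_of_not_even hs)⟩
    rcases hr.lt_or_eq with hrn | hrn
    · exact fwd M hrn (zigzag_succ_of_even hs')
    · exact turn M s hM rfl hrn (zigzag_succ_of_not_even hs)

/-- An orbit with a peak is dihedral. -/
theorem isDihedralOrbit_of_peak [Finite Q] (hM : IsPartialMatching M) (hN : IsPartialMatching N)
    {t : Q} (h1 : M t ⋖ t) (h2 : N t ⋖ t) : IsDihedralOrbit M N (orbitMN M N t) := by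
  obtain ⟨n, h0, h⟩ := exists_isLadder hM hN h1 h2
  have closed : ∀ x ∈ IsLadder.carrier (zigzag M N t) (zigzag N M t) n,
      (M x ∈ IsLadder.carrier (zigzag M N t) (zigzag N M t) n ∧ M x ≠ x) ∧
      (N x ∈ IsLadder.carrier (zigzag M N t) (zigzag N M t) n ∧ N x ≠ x) := by
    rintro x ⟨r, hr, rfl | rfl⟩
    · exact map_zigzag_mem_carrier hM.involutive hN.involutive h0 h hr
    · rw [IsLadder.carrier_comm]
      exact (map_zigzag_mem_carrier hN.involutive hM.involutive h0 h.symm hr).symm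
  have heq : orbitMN M N t = IsLadder.carrier (zigzag M N t) (zigzag N M t) n := by
    refine Set.Subset.antisymm (orbitMN_subset ⟨0, Nat.zero_le _, Or.inl rfl⟩
      fun x hx => ⟨(closed x hx).1.1, (closed x hx).2.1⟩) ?_
    rintro x ⟨r, -, rfl | rfl⟩
    · exact zigzag_mem_orbitMN M N t r
    · rw [orbitMN_comm]
      exact zigzag_mem_orbitMN N M t r
  rw [heq]
  exact ⟨⟨n, h.isDihedralInterval⟩, fun x hx => ⟨(closed x hx).1.2, (closed x hx).2.2⟩⟩

/-- An orbit with a valley has no fixed points. -/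
theorem ne_of_valley [Finite Q] (hM : IsPartialMatching M) (hN : IsPartialMatching N) {t : Q}
    (h1 : t ⋖ M t) (h2 : t ⋖ N t) : ∀ x ∈ orbitMN M N t, M x ≠ x ∧ N x ≠ x :=
  (isDihedralOrbit_of_peak hM.dual hN.dual h1.toDual h2.toDual).2

/-- The orbit of a maximal fixed point of `N`, if it has no valley, is totally ordered. -/
theorem total_of_fixed (hM : IsPartialMatching M) (hN : IsPartialMatching N) {t : Q}
    (ht : Maximal (· ∈ orbitMN M N t) t) (hNt : N t = t)
    (hv : ∀ x ∈ orbitMN M N t, ¬ (x ⋖ M x ∧ x ⋖ N x)) :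
    ∀ x ∈ orbitMN M N t, ∀ y ∈ orbitMN M N t, x ≤ y ∨ y ≤ x := by
  set c := zigzag M N t with hc
  have sub : orbitMN M N t ⊆ {x | ∃ r, x = c r ∧ ∀ s < r, c (s + 1) ⋖ c s} := by
    refine orbitMN_subset ⟨0, rfl, by simp⟩ ?_
    rintro x ⟨r, rfl, hr⟩
    have fwd : ∀ T : Q → Q, IsPartialMatching T → c (r + 1) = T (c r) → ¬ c r ⋖ T (c r) →
        ∃ k, T (c r) = c k ∧ ∀ s < k, c (s + 1) ⋖ c s := by
      intro T hT e hup
      rcases hT.covBy_or_eq (c r) with h | h | h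
      · refine ⟨r + 1, e.symm, fun s hs => ?_⟩
        rcases (Nat.lt_succ_iff.1 hs).lt_or_eq with hs | rfl
        exacts [hr s hs, e ▸ h]
      · exact ⟨r, h, hr⟩
      · exact absurd h hup
    rcases r with _ | s
    · refine ⟨fwd M hM rfl fun h => ?_, ⟨0, hNt, hr⟩⟩
      exact ht.not_gt (map_left_mem_orbitMN (mem_orbitMN_self M N t)) h.lt
    have hcov := hr s (Nat.lt_succ_self s)
    have hr' : ∀ k < s, c (k + 1) ⋖ c k := fun k hk => hr k (hk.trans (Nat.lt_succ_self s))
    have hvs := hv _ (zigzag_mem_orbitMN M N t (s + 1))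
    by_cases hs : Even s
    · have e : M (c (s + 1)) = c s := by rw [hc, zigzag_succ_of_even hs, hM.involutive]
      refine ⟨⟨s, e, hr'⟩, fwd N hN
        (zigzag_succ_of_not_even (by simpa [Nat.even_add_one] using hs)) fun h => ?_⟩
      exact hvs ⟨e.symm ▸ hcov, h⟩
    · have e : N (c (s + 1)) = c s := by rw [hc, zigzag_succ_of_not_even hs, hN.involutive]
      refine ⟨fwd M hM
        (zigzag_succ_of_even (by simpa [Nat.even_add_one] using hs)) fun h => ?_, ⟨s, e, hr'⟩⟩
      exact hvs ⟨h, e.symm ▸ hcov⟩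
  have anti : ∀ r s, r ≤ s → (∀ k < s, c (k + 1) ⋖ c k) → c s ≤ c r := by
    intro r s hrs
    induction s, hrs using Nat.le_induction with
    | base => exact fun _ => le_rfl
    | succ s hrs ih =>
      exact fun h => (h s (Nat.lt_succ_self s)).le.trans
        (ih fun k hk => h k (hk.trans (Nat.lt_succ_self s)))
  intro x hx y hy
  obtain ⟨r, rfl, hr⟩ := sub hx
  obtain ⟨s, rfl, hs⟩ := sub hy
  exact (le_total s r).imp (fun h => anti s r h hr) (fun h => anti r s h hs)

theorem isDihedralOrbit_or_isChainLikeOrbit [Finite Q] (hM : IsPartialMatching M)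
    (hN : IsPartialMatching N) (u : Q) :
    IsDihedralOrbit M N (orbitMN M N u) ∨ IsChainLikeOrbit M N (orbitMN M N u) := by
  refine or_iff_not_imp_left.2 fun hnd => ?_
  have horb : ∀ {x}, x ∈ orbitMN M N u → orbitMN M N x = orbitMN M N u :=
    fun hx => orbitMN_eq_of_mem hM.involutive hN.involutive hx
  have hpeak : ∀ x ∈ orbitMN M N u, ¬ (M x ⋖ x ∧ N x ⋖ x) := fun x hx h =>
    hnd (horb hx ▸ isDihedralOrbit_of_peak hM hN h.1 h.2)
  have hne : (orbitMN M N u).Nonempty := ⟨u, mem_orbitMN_self M N u⟩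
  obtain ⟨t, ht⟩ := (Set.toFinite (orbitMN M N u)).exists_maximal hne
  obtain ⟨b, hb⟩ := (Set.toFinite (orbitMN M N u)).exists_minimal hne
  have htfix : M t = t ∨ N t = t := by
    rcases hM.covBy_or_eq_of_maximal ht (map_left_mem_orbitMN ht.1) with h1 | h1
    · rcases hN.covBy_or_eq_of_maximal ht (map_right_mem_orbitMN ht.1) with h2 | h2
      exacts [absurd ⟨h1, h2⟩ (hpeak t ht.1), Or.inr h2]
    · exact Or.inl h1
  have hvalley : ∀ x ∈ orbitMN M N u, ¬ (x ⋖ M x ∧ x ⋖ N x) := by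
    intro x hx h
    have := ne_of_valley hM hN h.1 h.2 t (by rw [horb hx]; exact ht.1)
    exact htfix.elim this.1 this.2
  have hbfix : M b = b ∨ N b = b := by
    rcases hM.covBy_or_eq_of_minimal hb (map_left_mem_orbitMN hb.1) with h1 | h1
    · rcases hN.covBy_or_eq_of_minimal hb (map_right_mem_orbitMN hb.1) with h2 | h2
      exacts [absurd ⟨h1, h2⟩ (hvalley b hb.1), Or.inr h2]
    · exact Or.inl h1
  have htot : ∀ x ∈ orbitMN M N u, ∀ y ∈ orbitMN M N u, x ≤ y ∨ y ≤ x := by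
    have htu : t ∈ orbitMN M N u := ht.1
    rw [← horb htu] at ht hvalley ⊢
    rcases htfix with h | h
    · rw [orbitMN_comm] at ht hvalley ⊢
      exact total_of_fixed hN hM ht h fun x hx hx' => hvalley x hx hx'.symm
    · exact total_of_fixed hM hN ht h hvalley
  refine ⟨htot, ⟨b, hb.1, fun z hz => ?_, hbfix⟩, t, ht.1, fun z hz => ?_, htfix⟩
  · exact (htot b hb.1 z hz).elim id fun h => hb.2 hz h
  · exact (htot z hz t ht.1).elim id fun h => ht.2 hz h

end IsPartialMatching

section Transfer

variable {P Q : Type*} [PartialOrder P] [PartialOrder Q] (f : Q ↪o P)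

theorem IsDihedralIntervalOfRank.image {O : Set Q} {n : ℕ} (h : IsDihedralIntervalOfRank O n) :
    IsDihedralIntervalOfRank (f '' O) n := by
  obtain ⟨hfin, ρ, ⟨b, hb, hbmin, hρb⟩, ⟨t, ht, htmax, hρt⟩, hcov, hcard, hlt⟩ := h
  have hext : ∀ x, Function.extend f ρ 0 (f x) = ρ x := fun x => f.injective.extend_apply ρ 0 x
  refine ⟨hfin.image f, Function.extend f ρ 0, ⟨f b, ⟨b, hb, rfl⟩, ?_, (hext b).trans hρb⟩,
    ⟨f t, ⟨t, ht, rfl⟩, ?_, (hext t).trans hρt⟩, ?_, ?_, ?_⟩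
  · rintro _ ⟨z, hz, rfl⟩
    exact f.le_iff_le.2 (hbmin z hz)
  · rintro _ ⟨z, hz, rfl⟩
    exact f.le_iff_le.2 (htmax z hz)
  · rintro _ _ ⟨⟨x, hx, rfl⟩, ⟨y, hy, rfl⟩, hxy, hno⟩
    rw [hext, hext]
    exact hcov x y ⟨hx, hy, f.lt_iff_lt.1 hxy, fun c hc h =>
      hno (f c) ⟨c, hc, rfl⟩ ⟨f.lt_iff_lt.2 h.1, f.lt_iff_lt.2 h.2⟩⟩
  · intro i h0 hi
    rw [← hcard i h0 hi, ← Set.ncard_image_of_injective _ f.injective]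
    congr 1
    ext z
    constructor
    · rintro ⟨⟨x, hx, rfl⟩, hz⟩
      exact ⟨x, ⟨hx, (hext x).symm.trans hz⟩, rfl⟩
    · rintro ⟨x, ⟨hx, hz⟩, rfl⟩
      exact ⟨⟨x, hx, rfl⟩, (hext x).trans hz⟩
  · rintro _ ⟨x, hx, rfl⟩ _ ⟨y, hy, rfl⟩ h
    rw [hext, hext] at h
    exact f.lt_iff_lt.2 (hlt x hx y hy h)

variable {f} {M N : P → P} {M' N' : Q → Q}

theorem IsDihedralOrbit.image (hM : ∀ x, f (M' x) = M (f x)) (hN : ∀ x, f (N' x) = N (f x))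
    {O : Set Q} (h : IsDihedralOrbit M' N' O) : IsDihedralOrbit M N (f '' O) := by
  obtain ⟨⟨n, hn⟩, hfix⟩ := h
  refine ⟨⟨n, hn.image f⟩, ?_⟩
  rintro _ ⟨x, hx, rfl⟩
  rw [← hM, ← hN]
  exact ⟨f.injective.ne (hfix x hx).1, f.injective.ne (hfix x hx).2⟩

theorem IsChainLikeOrbit.image (hM : ∀ x, f (M' x) = M (f x)) (hN : ∀ x, f (N' x) = N (f x))
    {O : Set Q} (h : IsChainLikeOrbit M' N' O) : IsChainLikeOrbit M N (f '' O) := by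
  obtain ⟨htot, ⟨b, hb, hbmin, hbfix⟩, t, ht, htmax, htfix⟩ := h
  refine ⟨?_, ⟨f b, ⟨b, hb, rfl⟩, ?_, ?_⟩, f t, ⟨t, ht, rfl⟩, ?_, ?_⟩
  · rintro _ ⟨x, hx, rfl⟩ _ ⟨y, hy, rfl⟩
    exact (htot x hx y hy).imp f.le_iff_le.2 f.le_iff_le.2
  · rintro _ ⟨z, hz, rfl⟩
    exact f.le_iff_le.2 (hbmin z hz)
  · rw [← hM, ← hN]
    exact hbfix.imp (congrArg f) (congrArg f)
  · rintro _ ⟨z, hz, rfl⟩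
    exact f.le_iff_le.2 (htmax z hz)
  · rw [← hM, ← hN]
    exact htfix.imp (congrArg f) (congrArg f)

theorem image_orbitMN (hM : ∀ x, f (M' x) = M (f x)) (hN : ∀ x, f (N' x) = N (f x)) (u : Q) :
    f '' orbitMN M' N' u = orbitMN M N (f u) := by
  refine Set.Subset.antisymm (Set.image_subset_iff.2 ?_) (orbitMN_subset ?_ ?_)
  · refine orbitMN_subset (mem_orbitMN_self M N (f u)) fun x hx => ⟨?_, ?_⟩
    · rw [Set.mem_preimage, hM]
      exact map_left_mem_orbitMN hx
    · rw [Set.mem_preimage, hN]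
      exact map_right_mem_orbitMN hx
  · exact ⟨u, mem_orbitMN_self M' N' u, rfl⟩
  · rintro _ ⟨x, hx, rfl⟩
    exact ⟨⟨M' x, map_left_mem_orbitMN hx, hM x⟩, ⟨N' x, map_right_mem_orbitMN hx, hN x⟩⟩

end Transfer

section Restrict

variable {P : Type*} [PartialOrder P] {w : P} {M : P → P}

/-- A special partial matching of `w` as a self-map of the order ideal `Set.Iic w`. -/
def IsSPMof.restrict (hM : IsSPMof w M) (x : Set.Iic w) : Set.Iic w := ⟨M x, hM.1 x x.2⟩

theorem Set.Iic.coe_covBy_coe {x y : Set.Iic w} : (x : P) ⋖ y ↔ x ⋖ y :=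
  ⟨fun h => ⟨h.1, fun _ h1 h2 => h.2 h1 h2⟩,
    fun h => ⟨h.1, fun c h1 h2 => h.2 (c := ⟨c, h2.le.trans y.2⟩) h1 h2⟩⟩

theorem IsSPMof.isPartialMatching_restrict (hM : IsSPMof w M) :
    IsPartialMatching hM.restrict where
  involutive x := Subtype.ext (hM.2.1 x x.2)
  covBy_or_eq x := (hM.2.2.2.1 x x.2).imp Set.Iic.coe_covBy_coe.1
    (Or.imp Subtype.ext Set.Iic.coe_covBy_coe.1)
  map_lt x y hxy hne := hM.2.2.2.2 x y x.2 y.2 (Set.Iic.coe_covBy_coe.2 hxy)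
    fun h => hne (Subtype.ext h)

end Restrict

/-- Let `P` be a pircon, `w ∈ P` non-minimal, and `M, N ∈ SPM_w`.
Then every orbit of `⟨M,N⟩` acting on `P_{≤ w}` is either dihedral or chain-like. -/
theorem stmt3 {P : Type*} [PartialOrder P] (hP : IsPircon P)
    (w : P) (hw : ¬ IsMin w) (M N : P → P)
    (hM : IsSPMof w M) (hN : IsSPMof w N)
    (u : P) (hu : u ≤ w) :
    IsDihedralOrbit M N (orbitMN M N u) ∨ IsChainLikeOrbit M N (orbitMN M N u) := by
  have : Finite (Set.Iic w) := (hP w hw).1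
  have hMf : ∀ x, OrderEmbedding.subtype (· ∈ Set.Iic w) (hM.restrict x) = M x := fun _ => rfl
  have hNf : ∀ x, OrderEmbedding.subtype (· ∈ Set.Iic w) (hN.restrict x) = N x := fun _ => rfl
  have himage := image_orbitMN hMf hNf ⟨u, hu⟩
  change _ = orbitMN M N u at himage
  rw [← himage]
  exact (IsPartialMatching.isDihedralOrbit_or_isChainLikeOrbit hM.isPartialMatching_restrict
    hN.isPartialMatching_restrict ⟨u, hu⟩).imp (·.image hMf hNf) (·.image hMf hNf)
end

section
/- With the endomorphisms L_s, L_r, Γ_s, Γ_r, I of 𝔐 as defined: if d is even then I ∘ L_s = Γ_s ∘ I and I ∘ L_r = Γ_r ∘ I, while if d is odd then I ∘ L_s = Γ_r ∘ I and I ∘ L_r = Γ_s ∘ I. -/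
noncomputable section

/-- The ring `ℤ[q^{1/2}, q^{-1/2}]`, realized as Laurent polynomials in `T = q^{1/2}`. -/
abbrev Rq : Type := LaurentPolynomial ℤ

/-- The element `q = (q^{1/2})²`. -/
def qq : Rq := LaurentPolynomial.T 2

/-- The free `Rq`-module `𝔐` with basis `m_0, …, m_{d-1}`. -/
abbrev FM (d : ℕ) : Type := Fin d →₀ Rq

/-- Basis vector `m_p`. -/
def m {d : ℕ} (p : Fin d) : FM d := Finsupp.single p 1

/-- Value of `L_s` on the basis vector `m_p`. -/
def LsB (d : ℕ) (x : Rq) (p : Fin d) : FM d :=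
  if Odd p.val then
    qq • m ⟨p.val - 1, by have := p.isLt; omega⟩ + (qq - 1) • m p
  else if h : p.val < d - 1 then
    m ⟨p.val + 1, by have := p.isLt; omega⟩
  else x • m p

/-- Value of `L_r` on the basis vector `m_p`. -/
def LrB (d : ℕ) (x : Rq) (p : Fin d) : FM d :=
  if Even p.val ∧ 0 < p.val then
    qq • m ⟨p.val - 1, by have := p.isLt; omega⟩ + (qq - 1) • m p
  else if h : Odd p.val ∧ p.val < d - 1 then
    m ⟨p.val + 1, by have := p.isLt; omega⟩
  else x • m p

/-- Value of `Γ_s` on the basis vector `m_p`. -/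
def GsB (d : ℕ) (x : Rq) (p : Fin d) : FM d :=
  if Odd p.val then
    m ⟨p.val - 1, by have := p.isLt; omega⟩
  else if h : p.val < d - 1 then
    qq • m ⟨p.val + 1, by have := p.isLt; omega⟩ + (qq - 1) • m p
  else x • m p

/-- Value of `Γ_r` on the basis vector `m_p`. -/
def GrB (d : ℕ) (x : Rq) (p : Fin d) : FM d :=
  if Even p.val ∧ 0 < p.val then
    m ⟨p.val - 1, by have := p.isLt; omega⟩
  else if h : Odd p.val ∧ p.val < d - 1 then
    qq • m ⟨p.val + 1, by have := p.isLt; omega⟩ + (qq - 1) • m p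
  else x • m p

/-- Value of the involution `I` on the basis vector `m_p`: `I(m_p) = m_{d-p-1}`. -/
def IB (d : ℕ) (p : Fin d) : FM d :=
  m ⟨d - p.val - 1, by have := p.isLt; omega⟩

/-- The endomorphism `L_s` of `𝔐` (linear extension of `LsB`). -/
def Ls (d : ℕ) (x : Rq) : FM d →ₗ[Rq] FM d := Finsupp.linearCombination Rq (LsB d x)

/-- The endomorphism `L_r` of `𝔐`. -/
def Lr (d : ℕ) (x : Rq) : FM d →ₗ[Rq] FM d := Finsupp.linearCombination Rq (LrB d x)

/-- The endomorphism `Γ_s` of `𝔐`. -/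
def Gs (d : ℕ) (x : Rq) : FM d →ₗ[Rq] FM d := Finsupp.linearCombination Rq (GsB d x)

/-- The endomorphism `Γ_r` of `𝔐`. -/
def Gr (d : ℕ) (x : Rq) : FM d →ₗ[Rq] FM d := Finsupp.linearCombination Rq (GrB d x)

/-- The endomorphism `I` of `𝔐`. -/
def Iop (d : ℕ) : FM d →ₗ[Rq] FM d := Finsupp.linearCombination Rq (IB d)

/-- Value of `I` on a basis vector. -/
theorem Iop_m {d : ℕ} (p : Fin d) : Iop d (m p) = m ⟨d - p.val - 1, by omega⟩ := by
  simp [Iop, IB, m]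

/-- Two endomorphisms of `𝔐` linked by `I` are determined by their values on basis vectors. -/
theorem Iop_comp_eq {d : ℕ} {f g : Fin d → FM d}
    (h : ∀ p : Fin d, Iop d (f p) = g ⟨d - p.val - 1, by omega⟩) :
    Iop d ∘ₗ Finsupp.linearCombination Rq f = Finsupp.linearCombination Rq g ∘ₗ Iop d := by
  ext1 p
  ext1
  simpa [Iop, IB, m] using h p

/-- With `L_s, L_r, Γ_s, Γ_r, I` as defined: if `d` is even then
`I ∘ L_s = Γ_s ∘ I` and `I ∘ L_r = Γ_r ∘ I`, while if `d` is odd then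
`I ∘ L_s = Γ_r ∘ I` and `I ∘ L_r = Γ_s ∘ I`. -/
theorem stmt5 (d : ℕ) (hd : 1 ≤ d) (x : Rq) (hx : x = qq ∨ x = -1) :
    (Even d → Iop d ∘ₗ Ls d x = Gs d x ∘ₗ Iop d ∧ Iop d ∘ₗ Lr d x = Gr d x ∘ₗ Iop d) ∧
    (Odd d → Iop d ∘ₗ Ls d x = Gr d x ∘ₗ Iop d ∧ Iop d ∘ₗ Lr d x = Gs d x ∘ₗ Iop d) := by
  constructor
  all_goals
    intro hpar
    constructor
    all_goals
      refine Iop_comp_eq fun ⟨p, hp⟩ => ?_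
      simp only [LsB, LrB, GsB, GrB, Nat.odd_iff, Nat.even_iff] at hpar ⊢
      split_ifs <;> first
        | omega
        | (simp only [map_add, map_smul, Iop_m]
           repeat' first | exact congrArg m (Fin.ext (by dsimp only; omega)) | rfl | congr 1)

end
end

section
/- Let (P, ℳ) be a refined pircon that is graded with rank function ρ. For all u, w ∈ P with u ≤ w, the Kazhdan–Lusztig R^{−1}-polynomial satisfies deg R^{−1}_{u,w}(q) = ρ(w) − ρ(u). -/
open Polynomial

/-- `R` is the family of Kazhdan–Lusztig `R^x`-polynomials of the refined pircon
`(P, ℳ)`, where `ℳ w` is the chosen special partial matching of each non-minimal `w`,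
`q = X` and `x ∈ {q, -1}`:  `R w w = 1`, `R u w = 0` when `u ≰ w`, and for `u < w` the
three-case recursion driven by `M_w = ℳ w` holds. -/
def IsKLFamily {P : Type*} [PartialOrder P] (ℳ : P → P → P) (x : Polynomial ℤ)
    (R : P → P → Polynomial ℤ) : Prop :=
  (∀ w : P, R w w = 1) ∧ (∀ u w : P, ¬ u ≤ w → R u w = 0) ∧
  ∀ u w : P, u < w →
    (ℳ w u ⋖ u → R u w = R (ℳ w u) (ℳ w w)) ∧
    (u ⋖ ℳ w u →
      R u w = (X - 1) * R u (ℳ w w) + X * R (ℳ w u) (ℳ w w)) ∧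
    (ℳ w u = u → R u w = (X - 1 - x) * R u (ℳ w w))

/-- In a pircon, `x ≤ y` means that `y` can be reached from `x` by a chain of covers. -/
theorem IsPircon.reflTransGen_covBy {P : Type*} [PartialOrder P] (hP : IsPircon P)
    {x y : P} (hxy : x ≤ y) : Relation.ReflTransGen (· ⋖ ·) x y := by
  have hfin : ∀ a b : P, (Set.Icc a b).Finite := by
    intro a b
    by_cases hb : IsMin b
    · exact (Set.finite_singleton b).subset fun z hz => hb.eq_of_le hz.2
    · exact (hP b hb).1.subset Set.Icc_subset_Iic_self
  let := LocallyFiniteOrder.ofFiniteIcc hfin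
  exact le_iff_reflTransGen_covBy.mp hxy

/-- The lifting property of special partial matchings: a common lower bound of `u` and `M u`
is below `M w`. -/
theorem IsSPMof.le_of_le_of_le {P : Type*} [PartialOrder P] (hP : IsPircon P) {w : P}
    {M : P → P} (hM : IsSPMof w M) {u : P} (huw : u ≤ w) :
    ∀ z, z ≤ u → z ≤ M u → z ≤ M w := by
  obtain ⟨-, hinv, -, -, hmono⟩ := hM
  induction hP.reflTransGen_covBy huw using Relation.ReflTransGen.head_induction_on with
  | refl => exact fun z _ hz => hz
  | @head a c hac hcw ih =>
    intro z hza hzM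
    have hcw' : c ≤ w :=
      hcw.head_induction_on (motive := fun x _ => x ≤ w) le_rfl fun h _ => h.le.trans
    refine ih hcw' z (hza.trans hac.le) ?_
    by_cases h : M a = c
    · rwa [← h, hinv a huw]
    · exact hzM.trans (hmono a c huw hcw' hac h).le

/-- The `R^{-1}`-polynomials are monic, of degree the difference of the ranks. -/
theorem IsKLFamily.monic_and_natDegree_add {P : Type*} [PartialOrder P] (hP : IsPircon P)
    {ℳ : P → P → P} (hℳ : ∀ w : P, ¬ IsMin w → IsSPMof w (ℳ w))
    {ρ : P → ℕ} (hρ : ∀ a b : P, a ⋖ b → ρ b = ρ a + 1)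
    {R : P → P → Polynomial ℤ} (hR : IsKLFamily ℳ (-1) R) {u w : P} (huw : u ≤ w) :
    (R u w).Monic ∧ (R u w).natDegree + ρ u = ρ w := by
  induction hn : ρ w using Nat.strong_induction_on generalizing u w with
  | _ n ih =>
  subst hn
  obtain ⟨hone, hzero, hrec⟩ := hR
  rcases huw.eq_or_lt with rfl | hlt
  · simp [hone]
  have hM := hℳ w hlt.not_isMin
  have hlift := hM.le_of_le_of_le hP huw
  obtain ⟨-, -, hMw, hcases, -⟩ := hM
  have hρw := hρ _ _ hMw
  have ih' : ∀ v, v ≤ ℳ w w → (R v (ℳ w w)).Monic ∧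
      (R v (ℳ w w)).natDegree + ρ v = ρ (ℳ w w) :=
    fun v hv => ih _ (by omega) hv rfl
  obtain ⟨hdown, hup, hfix⟩ := hrec u w hlt
  rcases hcases u huw with h | h | h
  · obtain ⟨hmonic, hdeg⟩ := ih' _ (hlift _ h.le le_rfl)
    have := hρ _ _ h
    rw [hdown h]
    exact ⟨hmonic, by omega⟩
  · obtain ⟨hmonic, hdeg⟩ := ih' u (hlift u le_rfl h.ge)
    rw [hfix h, sub_neg_eq_add, sub_add_cancel]
    refine ⟨monic_X.mul hmonic, ?_⟩
    rw [monic_X.natDegree_mul hmonic, natDegree_X]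
    omega
  · obtain ⟨hmonic, hdeg⟩ := ih' u (hlift u le_rfl h.le)
    have hρu := hρ _ _ h
    have hX : (X - 1 : Polynomial ℤ).Monic := monic_X_sub_C 1
    have hprod : ((X - 1) * R u (ℳ w w)).natDegree = (R u (ℳ w w)).natDegree + 1 := by
      rw [hX.natDegree_mul hmonic, add_comm, ← C_1, natDegree_X_sub_C]
    have hlow : (X * R (ℳ w u) (ℳ w w)).degree < ((X - 1) * R u (ℳ w w)).degree := by
      by_cases hle : ℳ w u ≤ ℳ w w
      · obtain ⟨hmonic', hdeg'⟩ := ih' _ hle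
        apply degree_lt_degree
        rw [hprod, monic_X.natDegree_mul hmonic', natDegree_X]
        omega
      · rw [hzero _ _ hle, mul_zero, degree_zero, bot_lt_iff_ne_bot, Ne, degree_eq_bot]
        exact (hX.mul hmonic).ne_zero
    rw [hup h]
    refine ⟨(hX.mul hmonic).add_of_left hlow, ?_⟩
    rw [natDegree_add_eq_left_of_degree_lt hlow, hprod]
    omega

/-- Let `(P, ℳ)` be a refined pircon that is graded with rank function
`ρ`.  For all `u ≤ w`, the Kazhdan–Lusztig `R^{-1}`-polynomial (the case `x = -1`)
satisfies `deg R^{-1}_{u,w} = ρ w - ρ u`. -/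
theorem stmt8 {P : Type*} [PartialOrder P] (hP : IsPircon P)
    (ℳ : P → P → P) (hℳ : ∀ w : P, ¬ IsMin w → IsSPMof w (ℳ w))
    (bot : P) (hbot : ∀ z : P, bot ≤ z)
    (ρ : P → ℕ) (hρ0 : ρ bot = 0) (hρ : ∀ a b : P, a ⋖ b → ρ b = ρ a + 1)
    (R : P → P → Polynomial ℤ) (hR : IsKLFamily ℳ (-1) R)
    (u w : P) (huw : u ≤ w) :
    (R u w).natDegree = ρ w - ρ u := by
  have := (hR.monic_and_natDegree_add hP hℳ hρ huw).2
  omega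
end

section
/- Let (P, ℳ) be a refined pircon that is graded with rank function ρ. For all u, w ∈ P with u ≤ w, the identity R^{−1}_{u,w}(q) = (−q)^{ρ(w) − ρ(u)} · R^{q}_{u,w}(q^{−1}) holds (as an identity of Laurent polynomials in q). -/
open Polynomial

/-- In a poset with finite lower ideals, a function that goes up by one along covers is
strictly monotone. -/
theorem strictMono_of_covBy_succ {P : Type*} [PartialOrder P]
    (hfin : ∀ a b : P, a < b → (Set.Iic b).Finite)
    (ρ : P → ℕ) (hρ : ∀ a b : P, a ⋖ b → ρ b = ρ a + 1) : StrictMono ρ := by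
  intro a b hab
  induction hn : ρ b using Nat.strong_induction_on generalizing b with
  | _ n ih =>
    have hIco : (Set.Ico a b).Finite :=
      (hfin a b hab).subset fun x hx => hx.2.le
    obtain ⟨c, hac, hc⟩ := hIco.exists_le_maximal (Set.left_mem_Ico.2 hab)
    have hcb : c ⋖ b := by
      refine ⟨hc.prop.2, fun x hcx hxb => ?_⟩
      exact hcx.not_ge (hc.le_of_ge ⟨hac.trans hcx.le, hxb⟩ hcx.le)
    have hb := hρ c b hcb
    rcases hac.eq_or_lt with rfl | hac
    · omega
    · have := ih (ρ c) (by omega) hac rfl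
      omega

/-- Let `(P, ℳ)` be a refined pircon that is graded with rank function
`ρ`.  For all `u ≤ w`, in the ring of Laurent polynomials `ℤ[q, q⁻¹]` one has
`R^{-1}_{u,w}(q) = (-q)^{ρ w - ρ u} · R^{q}_{u,w}(q⁻¹)`, where `q = T 1` and
`R^{q}_{u,w}(q⁻¹)` is obtained by evaluating the polynomial `R^{q}_{u,w}` at `T (-1)`. -/
theorem stmt10 {P : Type*} [PartialOrder P] (hP : IsPircon P)
    (ℳ : P → P → P) (hℳ : ∀ w : P, ¬ IsMin w → IsSPMof w (ℳ w))
    (bot : P) (hbot : ∀ z : P, bot ≤ z)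
    (ρ : P → ℕ) (hρ0 : ρ bot = 0) (hρ : ∀ a b : P, a ⋖ b → ρ b = ρ a + 1)
    (Rm Rq : P → P → Polynomial ℤ)
    (hRm : IsKLFamily ℳ (-1) Rm) (hRq : IsKLFamily ℳ X Rq)
    (u w : P) (huw : u ≤ w) :
    Polynomial.toLaurent (Rm u w) =
      (-(LaurentPolynomial.T 1 : LaurentPolynomial ℤ)) ^ (ρ w - ρ u) *
        Polynomial.eval₂ (Int.castRingHom (LaurentPolynomial ℤ))
          (LaurentPolynomial.T (-1)) (Rq u w) := by
  have hmono : StrictMono ρ :=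
    strictMono_of_covBy_succ (fun _ b hab => (hP b hab.not_isMin).1) ρ hρ
  have hT : (LaurentPolynomial.T 1 : LaurentPolynomial ℤ) * LaurentPolynomial.T (-1) = 1 := by
    rw [← LaurentPolynomial.T_add]; simp
  have key : ∀ n : ℕ, ∀ u w : P, ρ w = n → toLaurent (Rm u w) =
      (-(LaurentPolynomial.T 1 : LaurentPolynomial ℤ)) ^ (ρ w - ρ u) *
        eval₂ (Int.castRingHom (LaurentPolynomial ℤ))
          (LaurentPolynomial.T (-1)) (Rq u w) := by
    intro n
    induction n using Nat.strong_induction_on with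
    | _ n ih =>
      intro u w hn
      by_cases huw : u ≤ w
      swap
      · simp [hRm.2.1 u w huw, hRq.2.1 u w huw]
      rcases huw.eq_or_lt with rfl | hlt
      · simp [hRm.1, hRq.1]
      obtain ⟨-, -, hcov, htri, -⟩ := hℳ w hlt.not_isMin
      have hw := hρ _ _ hcov
      have hltρ := hmono hlt
      obtain ⟨hm₁, hm₂, hm₃⟩ := hRm.2.2 u w hlt
      obtain ⟨hq₁, hq₂, hq₃⟩ := hRq.2.2 u w hlt
      have ihu := fun v => ih (ρ (ℳ w w)) (by omega) v (ℳ w w) rfl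
      have hexp : ρ w - ρ u = (ρ (ℳ w w) - ρ u) + 1 := by omega
      rcases htri u huw with h | h | h
      · have hu := hρ _ _ h
        rw [hm₁ h, hq₁ h, ihu, show ρ w - ρ u = ρ (ℳ w w) - ρ (ℳ w u) by omega]
      · rw [hm₃ h, hq₃ h, map_mul, ihu, hexp, pow_succ]
        simp only [eval₂_mul, eval₂_sub, eval₂_X, eval₂_one, map_sub, map_neg, map_one,
          toLaurent_X]
        ring
      · have hu := hρ _ _ h
        rw [hm₂ h, hq₂ h, map_add, map_mul, map_mul, ihu u]
        simp only [eval₂_mul, eval₂_add, eval₂_sub, eval₂_X, eval₂_one, map_sub, map_one,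
          toLaurent_X]
        by_cases hle : ℳ w u ≤ ℳ w w
        · have hle' := hmono.monotone hle
          rw [ihu (ℳ w u), hexp,
            show ρ (ℳ w w) - ρ u = (ρ (ℳ w w) - ρ (ℳ w u)) + 1 by omega]
          generalize ρ (ℳ w w) - ρ (ℳ w u) = k
          generalize eval₂ (Int.castRingHom (LaurentPolynomial ℤ)) _ (Rq u (ℳ w w)) = A
          generalize eval₂ (Int.castRingHom (LaurentPolynomial ℤ)) _ (Rq (ℳ w u) (ℳ w w)) = B
          generalize (LaurentPolynomial.T 1 : LaurentPolynomial ℤ) = q at hT ⊢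
          linear_combination
            ((-q) ^ (k + 1) * A - (-q) ^ k * q * B) * hT
        · rw [hRm.2.1 _ _ hle, hRq.2.1 _ _ hle, hexp, pow_succ]
          simp only [map_zero, eval₂_zero, mul_zero, add_zero]
          linear_combination
            (-(LaurentPolynomial.T 1 : LaurentPolynomial ℤ)) ^ (ρ (ℳ w w) - ρ u) *
              eval₂ (Int.castRingHom (LaurentPolynomial ℤ)) (LaurentPolynomial.T (-1))
                (Rq u (ℳ w w)) * hT
  exact key _ u w rfl
end

section
/- Let (P, ℳ) be a refined pircon, x ∈ {q, −1}, w ∈ P non-minimal, and M a special partial matching of w. Suppose that: (a) for every z ∈ P with z < w and M(z) covered by z, the restriction of M to P_{≤z} calculates the Kazhdan–Lusztig R^x-polynomials of (P, ℳ); and (b) there exists a strongly calculating special partial matching N of w that is strictly coherent with M. Then M is strongly calculating (in particular, M calculates the Kazhdan–Lusztig R^x-polynomials of (P, ℳ)). -/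
open Polynomial

/-- Two special partial matchings `M, N` of `w` are strictly coherent. -/
def StrictlyCoherent {P : Type*} [PartialOrder P] (M N : P → P) (w : P) : Prop :=
  ∀ m : ℕ, IsDihedralIntervalOfRank (orbitMN M N w) m →
    ∀ u, u ≤ w →
      (∀ n : ℕ, IsDihedralIntervalOfRank (orbitMN M N u) n → n ∣ m) ∧
      ((∀ a ∈ orbitMN M N u, ∀ b ∈ orbitMN M N u, a ≤ b ∨ b ≤ a) →
        (orbitMN M N u).ncard ∣ m)

/-- The restriction of the special partial matching `M` to `P_{≤ z}` calculates the
Kazhdan–Lusztig `R^x`-polynomials `R` of the refined pircon: for all `u ≤ z` the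
three-case recursion holds with `M` in place of the chosen matching. -/
def CalcAt {P : Type*} [PartialOrder P] (x : Polynomial ℤ) (R : P → P → Polynomial ℤ)
    (M : P → P) (z : P) : Prop :=
  ∀ u, u ≤ z →
    (M u ⋖ u → R u z = R (M u) (M z)) ∧
    (u ⋖ M u → R u z = (X - 1) * R u (M z) + X * R (M u) (M z)) ∧
    (M u = u → R u z = (X - 1 - x) * R u (M z))

/-- `M` (a special partial matching of `w`) is strongly calculating: its restriction to
`P_{≤ z}` calculates for every `z ≤ w` with `M z` covered by `z`. -/
def StronglyCalc {P : Type*} [PartialOrder P] (x : Polynomial ℤ)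
    (R : P → P → Polynomial ℤ) (M : P → P) (w : P) : Prop :=
  ∀ z, z ≤ w → M z ⋖ z → CalcAt x R M z

namespace SpecialMatching

section Orbits

/-- The `k`-th letter of the alternating word `a b a b ⋯`. -/
def letter {α : Type*} (a b : α) (k : ℕ) : α := if Even k then a else b

lemma letter_swap {α : Type*} (a b : α) (k : ℕ) : letter b a k = letter a b (k + 1) := by
  unfold letter
  by_cases h : Even k <;> simp [h, Nat.even_add_one]

lemma letter_swap_succ {α : Type*} (a b : α) (k : ℕ) : letter b a (k + 1) = letter a b k :=
  (letter_swap b a k).symm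

lemma letter_forall {α : Type*} {p : α → Prop} {a b : α} {k : ℕ}
    (h : p (letter a b k)) (h_succ : p (letter a b (k + 1))) : p a ∧ p b := by
  unfold letter at h h_succ
  by_cases hk : Even k <;> simp_all [Nat.even_add_one]

lemma forall_letter {α : Type*} {p : α → Prop} {a b : α} (ha : p a) (hb : p b) (k : ℕ) :
    p (letter a b k) := by
  unfold letter
  split_ifs <;> assumption

/-- Apply `M` and `N` alternately, `k` times in total, starting with `M`. -/
def alt {P : Type*} (M N : P → P) : ℕ → P → P
  | 0, t => t
  | k + 1, t => alt N M k (M t)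

lemma alt_succ {P : Type*} (M N : P → P) (k : ℕ) (t : P) :
    alt M N (k + 1) t = letter M N k (alt M N k t) := by
  induction k generalizing M N t with
  | zero => simp [alt, letter]
  | succ k ih =>
    rw [alt, ih, letter_swap]
    rfl

lemma alt_mem_orbitMN {P : Type*} (M N : P → P) (k : ℕ) (t : P) : alt M N k t ∈ orbitMN M N t := by
  induction k with
  | zero => exact Relation.ReflTransGen.refl
  | succ k ih =>
    refine Relation.ReflTransGen.tail ih ?_
    rw [alt_succ]
    unfold letter
    split_ifs
    · exact Or.inl rfl
    · exact Or.inr rfl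

lemma orbitMN_comm {P : Type*} (M N : P → P) (t : P) : orbitMN M N t = orbitMN N M t := by
  unfold orbitMN
  simp only [or_comm]

lemma orbitMN_subset {P : Type*} {M N : P → P} {S : Set P} {t : P} (ht : t ∈ S) (hM : ∀ x ∈ S, M x ∈ S)
    (hN : ∀ x ∈ S, N x ∈ S) : orbitMN M N t ⊆ S := by
  intro v hv
  induction hv with
  | refl => exact ht
  | tail _ h ih =>
    rcases h with rfl | rfl
    · exact hM _ ih
    · exact hN _ ih

variable {P : Type*} [PartialOrder P] {D : Set P} {M N : P → P}

/-- An involution of `D` that moves every element at most one step and has the lifting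
property. -/
structure IsLifting (D : Set P) (M : P → P) : Prop where
  mem : ∀ {x}, x ∈ D → M x ∈ D
  inv : ∀ {x}, x ∈ D → M (M x) = x
  tri : ∀ {x}, x ∈ D → M x ⋖ x ∨ M x = x ∨ x ⋖ M x
  map_le : ∀ {x y}, x ∈ D → y ∈ D → x ≤ y → M y ≤ y → M x ≤ y
  le_map : ∀ {x y}, x ∈ D → y ∈ D → x ≤ y → x ≤ M x → x ≤ M y

lemma IsLifting.dual (h : IsLifting D M) :
    IsLifting (P := Pᵒᵈ) (OrderDual.ofDual ⁻¹' D)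
      (fun a => OrderDual.toDual (M (OrderDual.ofDual a))) where
  mem hx := h.mem hx
  inv hx := h.inv hx
  tri hx := by
    rcases h.tri hx with h1 | h1 | h1
    · exact Or.inr (Or.inr h1.toDual)
    · exact Or.inr (Or.inl h1)
    · exact Or.inl h1.toDual
  map_le hx hy hxy h1 := h.le_map hy hx hxy h1
  le_map hx hy hxy h1 := h.map_le hy hx hxy h1

lemma IsLifting.covBy (h : IsLifting D M) {x : P} (hx : x ∈ D) (hlt : M x < x) : M x ⋖ x := by
  rcases h.tri hx with h1 | h1 | h1
  · exact h1
  · exact absurd h1 hlt.ne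
  · exact absurd h1.lt hlt.not_gt

lemma IsLifting.le_map_of_not_lt (h : IsLifting D M) {x : P} (hx : x ∈ D) (hlt : ¬ M x < x) :
    x ≤ M x := by
  rcases h.tri hx with h1 | h1 | h1
  · exact absurd h1.lt hlt
  · exact h1.ge
  · exact h1.le

/-- Along a relation `x < y` whose ends both descend, a lifting involution is strictly
monotone. -/
lemma IsLifting.map_lt_map (h : IsLifting D M) {x y : P} (hx : x ∈ D) (hy : y ∈ D)
    (hxy : x < y) (h1 : M x ≤ x) : M x < M y := by
  refine lt_of_le_of_ne (h.le_map (h.mem hx) hy (h1.trans hxy.le) (by rwa [h.inv hx])) ?_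
  intro he
  have := congrArg M he
  rw [h.inv hx, h.inv hy] at this
  exact hxy.ne this

lemma alt_mem (hM : IsLifting D M) (hN : IsLifting D N) {t : P} (ht : t ∈ D) (k : ℕ) :
    alt M N k t ∈ D := by
  induction k generalizing M N t with
  | zero => exact ht
  | succ k ih => exact ih hN hM (hM.mem ht)

lemma le_alt (hM : IsLifting D M) (hN : IsLifting D N) {d t : P} (hd : d ∈ D) (ht : t ∈ D)
    (hdM : d ≤ M d) (hdN : d ≤ N d) (hdt : d ≤ t) (k : ℕ) : d ≤ alt M N k t := by
  induction k generalizing M N t with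
  | zero => exact hdt
  | succ k ih => exact ih hN hM (hM.mem ht) hdN hdM (hM.le_map hd ht hdt hdM)

lemma alt_le (hM : IsLifting D M) (hN : IsLifting D N) {d t : P} (hd : d ∈ D) (ht : t ∈ D)
    (htM : M t ≤ t) (htN : N t ≤ t) (hdt : d ≤ t) (k : ℕ) : alt M N k d ≤ t := by
  induction k generalizing M N d with
  | zero => exact hdt
  | succ k ih => exact ih hN hM (hM.mem hd) htN htM (hM.map_le hd ht hdt htM)

lemma letter_alt_succ (hM : IsLifting D M) (hN : IsLifting D N) {t : P} (ht : t ∈ D) (k : ℕ) :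
    letter M N k (alt M N (k + 1) t) = alt M N k t := by
  rw [alt_succ]
  exact (forall_letter hM hN k : IsLifting D (letter M N k)).inv (alt_mem hM hN ht k)

/-- The alternating walk from `t` strictly descends for its first `n` steps. -/
def Descends (M N : P → P) (t : P) (n : ℕ) : Prop :=
  ∀ i < n, alt M N (i + 1) t < alt M N i t

lemma Descends.lt {t : P} {n : ℕ} (h : Descends M N t n) {i j : ℕ} (hij : i < j) (hj : j ≤ n) :
    alt M N j t < alt M N i t := by
  induction j, hij using Nat.le_induction with
  | base => exact h i (by omega)
  | succ j hij ih => exact (h j (by omega)).trans (ih (by omega))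

lemma Descends.le {t : P} {n : ℕ} (h : Descends M N t n) {i j : ℕ} (hij : i ≤ j) (hj : j ≤ n) :
    alt M N j t ≤ alt M N i t := by
  rcases hij.eq_or_lt with rfl | hij
  · exact le_rfl
  · exact (h.lt hij hj).le

lemma exists_descends (hD : D.Finite) (hM : IsLifting D M) (hN : IsLifting D N) {t : P}
    (ht : t ∈ D) : ∃ n, Descends M N t n ∧ ¬ alt M N (n + 1) t < alt M N n t := by
  classical
  have hex : ∃ n, ¬ alt M N (n + 1) t < alt M N n t := by
    by_contra! hall
    exact Set.infinite_of_injective_forall_mem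
      (strictAnti_nat_of_succ_lt (f := fun n => alt M N n t) hall).injective
      (fun n => alt_mem hM hN ht n) hD
  exact ⟨Nat.find hex, fun i hi => not_not.1 (Nat.find_min hex hi), Nat.find_spec hex⟩

/-- A maximal descending walk of positive length ends in a local minimum. -/
lemma Descends.isLocalMin (hM : IsLifting D M) (hN : IsLifting D N) {t : P} (ht : t ∈ D) {n : ℕ}
    (hn : 0 < n) (h : Descends M N t n) (hend : ¬ alt M N (n + 1) t < alt M N n t) :
    alt M N n t ≤ M (alt M N n t) ∧ alt M N n t ≤ N (alt M N n t) := by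
  obtain ⟨k, rfl⟩ : ∃ k, n = k + 1 := ⟨n - 1, by omega⟩
  refine letter_forall (p := fun S : P → P => alt M N (k + 1) t ≤ S (alt M N (k + 1) t)) (k := k) ?_ ?_
  · rw [letter_alt_succ hM hN ht]
    exact (h k (by omega)).le
  · rw [alt_succ M N (k + 1)] at hend
    exact (forall_letter hM hN (k + 1) : IsLifting D (letter M N (k + 1))).le_map_of_not_lt
      (alt_mem hM hN ht _) hend

lemma Descends.interlace (hM : IsLifting D M) (hN : IsLifting D N) {t : P} (ht : t ∈ D)
    {n n' : ℕ} (h : Descends M N t n) (i : ℕ) (hi : i + 1 ≤ n)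
    (hi' : i ≤ n') : alt M N (i + 1) t < alt N M i t := by
  induction i with
  | zero => exact h 0 (by omega)
  | succ i ih =>
    have hlt := ih (by omega) (by omega)
    have hstep := h (i + 1) (by omega)
    rw [alt_succ M N (i + 1)] at hstep ⊢
    rw [alt_succ N M i, letter_swap M N i]
    exact (forall_letter hM hN (i + 1) : IsLifting D (letter M N (i + 1))).map_lt_map
      (alt_mem hM hN ht _) (alt_mem hN hM ht _) hlt hstep.le

/-- If both `M` and `N` descend at `t`, the two alternating walks from `t` descend for the same
number of steps and end in the same element. -/
lemma exists_meet (hD : D.Finite) (hM : IsLifting D M) (hN : IsLifting D N) {t : P} (ht : t ∈ D)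
    (htM : M t < t) (htN : N t < t) :
    ∃ n, 0 < n ∧ Descends M N t n ∧ Descends N M t n ∧ alt M N n t = alt N M n t ∧
      alt M N n t < M (alt M N n t) ∧ alt M N n t < N (alt M N n t) := by
  obtain ⟨n, h, hend⟩ := exists_descends hD hM hN ht
  obtain ⟨n', h', hend'⟩ := exists_descends hD hN hM ht
  have hn : 0 < n := Nat.pos_of_ne_zero (by rintro rfl; exact hend htM)
  have hn' : 0 < n' := Nat.pos_of_ne_zero (by rintro rfl; exact hend' htN)
  obtain ⟨hminM, hminN⟩ := h.isLocalMin hM hN ht hn hend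
  obtain ⟨hminN', hminM'⟩ := h'.isLocalMin hN hM ht hn' hend'
  have hle : ∀ k, alt M N n t ≤ alt N M k t :=
    le_alt hN hM (alt_mem hM hN ht n) ht hminN hminM (h.le (Nat.zero_le n) le_rfl)
  have hle' : ∀ k, alt N M n' t ≤ alt M N k t :=
    le_alt hM hN (alt_mem hN hM ht n') ht hminM' hminN' (h'.le (Nat.zero_le n') le_rfl)
  obtain rfl : n = n' := by
    rcases lt_trichotomy n n' with hlt | heq | hlt
    · exact absurd (h'.interlace hN hM ht n hlt le_rfl) (hle (n + 1)).not_gt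
    · exact heq
    · exact absurd (h.interlace hM hN ht n' hlt le_rfl) (hle' (n' + 1)).not_gt
  have heq : alt M N n t = alt N M n t := le_antisymm (hle n) (hle' n)
  refine ⟨n, hn, h, h', heq, ?_⟩
  obtain ⟨k, rfl⟩ : ∃ k, n = k + 1 := ⟨n - 1, by omega⟩
  refine letter_forall (p := fun S : P → P => alt M N (k + 1) t < S (alt M N (k + 1) t)) (k := k) ?_ ?_
  · rw [letter_alt_succ hM hN ht]
    exact h k (by omega)
  · rw [heq, ← letter_swap, letter_alt_succ hN hM ht]
    exact h' k (by omega)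

/-- Dually, if both `M` and `N` ascend at `d`, some element above `d` is an upper bound of the
alternating walks from `d` and both `M` and `N` descend there. -/
lemma exists_join (hD : D.Finite) (hM : IsLifting D M) (hN : IsLifting D N) {d : P} (hd : d ∈ D)
    (hdM : d < M d) (hdN : d < N d) :
    ∃ n, d ≤ alt M N n d ∧ M (alt M N n d) < alt M N n d ∧ N (alt M N n d) < alt M N n d := by
  obtain ⟨n, -, h, -, -, h1, h2⟩ := exists_meet (P := Pᵒᵈ) (t := OrderDual.toDual d)
    hD hM.dual hN.dual hd hdM hdN
  have key : ∀ (k : ℕ) (M N : P → P) (x : P), alt (P := Pᵒᵈ)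
      (fun a => OrderDual.toDual (M (OrderDual.ofDual a)))
      (fun a => OrderDual.toDual (N (OrderDual.ofDual a))) k (OrderDual.toDual x) =
      OrderDual.toDual (alt M N k x) := by
    intro k
    induction k with
    | zero => intros; rfl
    | succ k ih => intro M N x; exact ih N M (M x)
  have hle := h.le (Nat.zero_le n) le_rfl
  rw [key] at h1 h2 hle
  exact ⟨n, hle, h1, h2⟩

/-- If `t` is fixed by `M` and not raised by `N`, the walk from `t` starting with `N` descends
until it reaches an element fixed by the next letter. -/
lemma exists_chain (hD : D.Finite) (hM : IsLifting D M) (hN : IsLifting D N) {t : P} (ht : t ∈ D)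
    (htM : M t = t) (htN : N t ≤ t) :
    ∃ k, Descends N M t k ∧ letter N M k (alt N M k t) = alt N M k t := by
  obtain ⟨k, h, hend⟩ := exists_descends hD hN hM ht
  refine ⟨k, h, ?_⟩
  rcases Nat.eq_zero_or_pos k with rfl | hk
  · exact htN.eq_of_not_lt hend
  obtain ⟨hminN, hminM⟩ := h.isLocalMin hN hM ht hk hend
  have hmem := alt_mem hN hM ht k
  rw [alt_succ] at hend
  by_contra hne
  have hup : alt N M k t < letter N M k (alt N M k t) :=
    lt_of_le_of_ne (forall_letter (p := fun S : P → P => alt N M k t ≤ S (alt N M k t)) hminN hminM k)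
      (Ne.symm hne)
  have hback : alt N M k t < letter N M (k + 1) (alt N M k t) := by
    obtain ⟨j, rfl⟩ : ∃ j, k = j + 1 := ⟨k - 1, by omega⟩
    rw [← letter_swap, letter_swap_succ, letter_alt_succ hN hM ht]
    exact h j (by omega)
  obtain ⟨hupN, hupM⟩ := letter_forall (p := fun S : P → P => alt N M k t < S (alt N M k t)) hup hback
  obtain ⟨n, hle, htopM, htopN⟩ := exists_join hD hM hN hmem hupM hupN
  have htop := alt_mem hM hN hmem n
  have hle1 : alt M N n (alt N M k t) ≤ t :=
    alt_le hM hN hmem ht htM.le htN (h.le (Nat.zero_le k) le_rfl) n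
  have hle2 : ∀ i ≤ k, alt N M (k - i) t ≤ alt M N n (alt N M k t) := by
    intro i
    induction i with
    | zero => intro _; exact hle
    | succ i ih =>
      intro hi
      have hprev := ih (by omega)
      obtain ⟨j, hj⟩ : ∃ j, k - i = j + 1 := ⟨k - i - 1, by omega⟩
      have hj' : k - (i + 1) = j := by omega
      rw [hj] at hprev
      rw [hj', ← letter_alt_succ hN hM ht]
      exact (forall_letter hN hM j : IsLifting D (letter N M j)).map_le (alt_mem hN hM ht _) htop
        hprev (forall_letter (p := fun S : P → P => S (alt M N n (alt N M k t)) ≤ _)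
          htopN.le htopM.le j)
  have heq : alt M N n (alt N M k t) = t := by
    refine le_antisymm hle1 ?_
    have := hle2 k le_rfl
    rwa [Nat.sub_self] at this
  rw [heq] at htopM
  exact htopM.ne htM

lemma orbitMN_eq_chain (hM : IsLifting D M) (hN : IsLifting D N) {t : P} (ht : t ∈ D)
    (htM : M t = t) {k : ℕ} (hend : letter N M k (alt N M k t) = alt N M k t) :
    orbitMN M N t = (fun i => alt N M i t) '' Set.Iic k := by
  apply Set.Subset.antisymm
  · have hstep : ∀ y ∈ (fun i => alt N M i t) '' Set.Iic k,
        N y ∈ (fun i => alt N M i t) '' Set.Iic k ∧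
        M y ∈ (fun i => alt N M i t) '' Set.Iic k := by
      rintro y ⟨i, hi, rfl⟩
      have hi : i ≤ k := hi
      refine letter_forall (a := N) (b := M) (k := i)
        (p := fun S : P → P => S (alt N M i t) ∈ (fun i => alt N M i t) '' Set.Iic k) ?_ ?_
      · rcases hi.eq_or_lt with rfl | hlt
        · exact ⟨i, le_refl i, hend.symm⟩
        · exact ⟨i + 1, hlt, alt_succ N M i t⟩
      · rcases i with _ | j
        · exact ⟨0, Nat.zero_le k, by simpa [letter, alt] using htM.symm⟩
        · refine ⟨j, Set.mem_Iic.2 (by omega), ?_⟩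
          rw [← letter_swap, letter_swap_succ, letter_alt_succ hN hM ht]
    exact orbitMN_subset ⟨0, Nat.zero_le k, rfl⟩ (fun y hy => (hstep y hy).2)
      (fun y hy => (hstep y hy).1)
  · rintro _ ⟨i, -, rfl⟩
    rw [orbitMN_comm]
    exact alt_mem_orbitMN N M i t

lemma Descends.chain_total {t : P} {k : ℕ} (h : Descends N M t k) :
    ∀ a ∈ (fun i => alt N M i t) '' Set.Iic k, ∀ b ∈ (fun i => alt N M i t) '' Set.Iic k,
      a ≤ b ∨ b ≤ a := by
  rintro _ ⟨i, hi, rfl⟩ _ ⟨j, hj, rfl⟩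
  rcases le_total i j with hij | hij
  · exact Or.inr (h.le hij hj)
  · exact Or.inl (h.le hij hi)

lemma Descends.ncard_chain {t : P} {k : ℕ} (h : Descends N M t k) :
    ((fun i => alt N M i t) '' Set.Iic k).ncard = k + 1 := by
  rw [Set.InjOn.ncard_image]
  · rw [Set.ncard_eq_toFinset_card']
    simp
  · intro i hi j hj hij
    rcases lt_trichotomy i j with hlt | heq | hlt
    · exact absurd hij (h.lt hlt hj).ne'
    · exact heq
    · exact absurd hij (h.lt hlt hi).ne

/-- The union of the first `n` steps of the two alternating walks from `t`. -/
def walks {P : Type*} (M N : P → P) (t : P) (n : ℕ) : Set P :=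
  {y | ∃ i ≤ n, y = alt M N i t ∨ y = alt N M i t}

lemma walks_comm {P : Type*} (M N : P → P) (t : P) (n : ℕ) : walks M N t n = walks N M t n := by
  unfold walks
  simp only [or_comm]

lemma map_alt_mem_walks (hM : IsLifting D M) (hN : IsLifting D N) {t : P} (ht : t ∈ D)
    {n : ℕ} (hn : 0 < n) (heq : alt M N n t = alt N M n t) {i : ℕ} (hi : i ≤ n) :
    M (alt M N i t) ∈ walks M N t n ∧ N (alt M N i t) ∈ walks M N t n := by
  refine letter_forall (k := i) (p := fun S : P → P => S (alt M N i t) ∈ walks M N t n) ?_ ?_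
  · rcases hi.eq_or_lt with rfl | hlt
    · obtain ⟨j, rfl⟩ : ∃ j, i = j + 1 := ⟨i - 1, by omega⟩
      rw [heq, letter_swap_succ, letter_alt_succ hN hM ht]
      exact ⟨j, by omega, Or.inr rfl⟩
    · exact ⟨i + 1, hlt, Or.inl (alt_succ M N i t).symm⟩
  · rcases i with _ | j
    · exact ⟨1, hn, Or.inr (by simp [letter, alt])⟩
    · rw [← letter_swap, letter_swap_succ, letter_alt_succ hM hN ht]
      exact ⟨j, by omega, Or.inl rfl⟩

lemma orbitMN_eq_walks (hM : IsLifting D M) (hN : IsLifting D N) {t : P} (ht : t ∈ D)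
    {n : ℕ} (hn : 0 < n) (heq : alt M N n t = alt N M n t) :
    orbitMN M N t = walks M N t n := by
  apply Set.Subset.antisymm
  · have hstep : ∀ y ∈ walks M N t n, M y ∈ walks M N t n ∧ N y ∈ walks M N t n := by
      rintro y ⟨i, hi, rfl | rfl⟩
      · exact map_alt_mem_walks hM hN ht hn heq hi
      · rw [walks_comm]
        exact (map_alt_mem_walks hN hM ht hn heq.symm hi).symm
    exact orbitMN_subset ⟨0, Nat.zero_le n, Or.inl rfl⟩ (fun y hy => (hstep y hy).1)
      (fun y hy => (hstep y hy).2)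
  · rintro _ ⟨i, -, rfl | rfl⟩
    · exact alt_mem_orbitMN M N i t
    · rw [orbitMN_comm]
      exact alt_mem_orbitMN N M i t

lemma walks_level_lt (hM : IsLifting D M) (hN : IsLifting D N) {t : P} (ht : t ∈ D)
    {n : ℕ} (h : Descends M N t n) (h' : Descends N M t n) {i j : ℕ} (hij : i < j) (hj : j ≤ n)
    {x y : P} (hx : x = alt M N j t ∨ x = alt N M j t) (hy : y = alt M N i t ∨ y = alt N M i t) :
    x < y := by
  rcases hx with rfl | rfl <;> rcases hy with rfl | rfl
  · exact h.lt hij hj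
  · exact (h.le hij hj).trans_lt (h.interlace hM hN ht i (by omega) (le_refl i))
  · exact (h'.le hij hj).trans_lt (h'.interlace hN hM ht i (by omega) (le_refl i))
  · exact h'.lt hij hj

lemma isDihedralInterval_orbitMN (hM : IsLifting D M) (hN : IsLifting D N) {t : P} (ht : t ∈ D)
    {n : ℕ} (hn : 0 < n) (h : Descends M N t n) (h' : Descends N M t n)
    (heq : alt M N n t = alt N M n t) (hdM : alt M N n t < M (alt M N n t))
    (hdN : alt M N n t < N (alt M N n t)) :
    IsDihedralIntervalOfRank (orbitMN M N t) n := by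
  classical
  rw [orbitMN_eq_walks hM hN ht hn heq]
  have hlev : ∀ {i j x y}, i < j → j ≤ n → (x = alt M N j t ∨ x = alt N M j t) →
      (y = alt M N i t ∨ y = alt N M i t) → x < y :=
    fun hij hj hx hy => walks_level_lt hM hN ht h h' hij hj hx hy
  have hincomp : ∀ {i x y}, i ≤ n → (x = alt M N i t ∨ x = alt N M i t) →
      (y = alt M N i t ∨ y = alt N M i t) → ¬ x < y := by
    intro i x y hi hx hy hxy
    rcases i with _ | j
    · rcases hx with rfl | rfl <;> rcases hy with rfl | rfl <;> exact lt_irrefl _ hxy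
    · rcases hx with rfl | rfl <;> rcases hy with rfl | rfl
      · exact lt_irrefl _ hxy
      · have hlt := h j (by omega)
        have hcov : alt M N (j + 1) t ⋖ alt M N j t := by
          rw [alt_succ] at hlt ⊢
          exact (forall_letter hM hN j : IsLifting D (letter M N j)).covBy (alt_mem hM hN ht j) hlt
        exact hcov.2 hxy (hlev (Nat.lt_succ_self j) hi (Or.inr rfl) (Or.inl rfl))
      · have hlt := h' j (by omega)
        have hcov : alt N M (j + 1) t ⋖ alt N M j t := by
          rw [alt_succ] at hlt ⊢
          exact (forall_letter hN hM j : IsLifting D (letter N M j)).covBy (alt_mem hN hM ht j) hlt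
        exact hcov.2 hxy (hlev (Nat.lt_succ_self j) hi (Or.inl rfl) (Or.inr rfl))
      · exact lt_irrefl _ hxy
  have hdist : ∀ i, 0 < i → i < n → alt M N i t ≠ alt N M i t := by
    intro i hi hin he
    have hup : alt M N i t < M (alt M N i t) ∧ alt M N i t < N (alt M N i t) := by
      obtain ⟨j, rfl⟩ : ∃ j, i = j + 1 := ⟨i - 1, by omega⟩
      refine letter_forall (k := j)
        (p := fun S : P → P => alt M N (j + 1) t < S (alt M N (j + 1) t)) ?_ ?_
      · rw [letter_alt_succ hM hN ht]
        exact h j (by omega)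
      · rw [he, ← letter_swap, letter_alt_succ hN hM ht]
        exact h' j (by omega)
    have hmin := le_alt hM hN (alt_mem hM hN ht i) ht hup.1.le hup.2.le
      (h.le (Nat.zero_le i) hin.le) n
    exact hmin.not_gt (h.lt hin le_rfl)
  have hρ : ∃ ρ : P → ℕ, ∀ i ≤ n, ∀ x, (x = alt M N i t ∨ x = alt N M i t) → ρ x = n - i := by
    refine ⟨fun x => if hx : ∃ i ≤ n, x = alt M N i t ∨ x = alt N M i t then n - hx.choose else 0,
      fun i hi x hx => ?_⟩
    have hex : ∃ i ≤ n, x = alt M N i t ∨ x = alt N M i t := ⟨i, hi, hx⟩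
    have hspec := hex.choose_spec
    simp only [dif_pos hex]
    rcases lt_trichotomy hex.choose i with hlt | he | hlt
    · exact absurd (hlev hlt hi hx hspec.2) (lt_irrefl x)
    · rw [he]
    · exact absurd (hlev hlt hspec.1 hspec.2 hx) (lt_irrefl x)
  obtain ⟨ρ, hρ⟩ := hρ
  have hle : ∀ {i x}, i ≤ n → (x = alt M N i t ∨ x = alt N M i t) →
      alt M N n t ≤ x ∧ x ≤ t := by
    intro i x hi hx
    constructor
    · rcases hi.eq_or_lt with rfl | hlt
      · rcases hx with rfl | rfl
        · exact le_rfl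
        · exact heq.le
      · exact (hlev hlt le_rfl (Or.inl rfl) hx).le
    · rcases Nat.eq_zero_or_pos i with rfl | hpos
      · rcases hx with rfl | rfl <;> exact le_rfl
      · exact (hlev (i := 0) hpos hi hx (Or.inl rfl)).le
  refine ⟨?_, ρ, ⟨alt M N n t, ⟨n, le_rfl, Or.inl rfl⟩, ?_, ?_⟩,
    ⟨t, ⟨0, Nat.zero_le n, Or.inl rfl⟩, ?_, ?_⟩, ?_, ?_, ?_⟩
  · refine Set.Finite.subset (((Set.finite_Iic n).image (fun i => alt M N i t)).union
      ((Set.finite_Iic n).image (fun i => alt N M i t))) ?_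
    rintro x ⟨i, hi, rfl | rfl⟩
    · exact Or.inl ⟨i, hi, rfl⟩
    · exact Or.inr ⟨i, hi, rfl⟩
  · rintro z ⟨i, hi, hz⟩
    exact (hle hi hz).1
  · simpa using hρ n le_rfl _ (Or.inl rfl)
  · rintro z ⟨i, hi, hz⟩
    exact (hle hi hz).2
  · simpa using hρ 0 (Nat.zero_le n) t (Or.inl rfl)
  · rintro x y ⟨⟨j, hj, hx⟩, ⟨i, hi, hy⟩, hxy, hno⟩
    rw [hρ j hj x hx, hρ i hi y hy]
    rcases lt_trichotomy i j with hlt | rfl | hlt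
    · rcases (Nat.succ_le_of_lt hlt).eq_or_lt with he | hlt2
      · omega
      · exact absurd ⟨hlev hlt2 hj hx (Or.inl rfl),
          hlev (Nat.lt_succ_self i) (by omega) (Or.inl rfl) hy⟩
          (hno (alt M N (i + 1) t) ⟨i + 1, by omega, Or.inl rfl⟩)
    · exact absurd hxy (hincomp hi hx hy)
    · exact absurd hxy (hlev hlt hi hy hx).not_gt
  · intro i hi hin
    rw [Set.ncard_eq_two]
    refine ⟨_, _, hdist (n - i) (by omega) (by omega), ?_⟩
    ext x
    constructor
    · rintro ⟨⟨j, hj, hx⟩, hxi⟩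
      rw [hρ j hj x hx] at hxi
      obtain rfl : j = n - i := by omega
      exact hx
    · intro hx
      refine ⟨⟨n - i, by omega, hx⟩, ?_⟩
      rw [hρ (n - i) (by omega) x hx]
      omega
  · rintro x ⟨i, hi, hx⟩ y ⟨j, hj, hy⟩ hxy
    rw [hρ i hi x hx, hρ j hj y hy] at hxy
    exact hlev (by omega) hi hx hy

end Orbits

section Operators

/-- The alternating product `A * B * A * ⋯` with `k` factors. -/
def word {E : Type*} [Monoid E] (A B : E) : ℕ → E
  | 0 => 1
  | k + 1 => A * word B A k

lemma word_succ {E : Type*} [Monoid E] (A B : E) (k : ℕ) :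
    word A B (k + 1) = word A B k * letter A B k := by
  induction k generalizing A B with
  | zero => simp [word, letter]
  | succ k ih =>
    rw [word, ih, letter_swap, ← mul_assoc]
    rfl

lemma word_add {E : Type*} [Monoid E] (A B : E) (n m : ℕ) :
    word A B (n + m) = word A B n * word (letter A B n) (letter A B (n + 1)) m := by
  induction n generalizing A B with
  | zero => simp [word, letter]
  | succ n ih =>
    rw [Nat.succ_add, word, ih, letter_swap A B n, letter_swap A B (n + 1), ← mul_assoc]
    rfl

variable {P : Type*} [PartialOrder P] {D : Set P} {M N : P → P} {x : ℤ[X]}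

open Classical in
/-- The operator on functions `P → ℤ[X]` given by the three-case recursion attached to `M`
on `D`; outside `D` it is multiplication by `X`. -/
noncomputable def hecke (D : Set P) (x : ℤ[X]) (M : P → P) : Module.End ℤ[X] (P → ℤ[X]) where
  toFun f u :=
    if u ∈ D then
      if M u < u then f (M u) else if M u = u then (X - 1 - x) * f u
      else (X - 1) * f u + X * f (M u)
    else X * f u
  map_add' f g := by
    ext1 u
    simp only [Pi.add_apply]
    split_ifs <;> ring
  map_smul' c f := by
    ext1 u
    simp only [Pi.smul_apply, smul_eq_mul, RingHom.id_apply]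
    split_ifs <;> ring

lemma hecke_of_lt {f : P → ℤ[X]} {u : P} (hu : u ∈ D) (h : M u < u) :
    hecke D x M f u = f (M u) := by
  simp [hecke, hu, h]

lemma hecke_of_eq {f : P → ℤ[X]} {u : P} (hu : u ∈ D) (h : M u = u) :
    hecke D x M f u = (X - 1 - x) * f u := by
  simp [hecke, hu, h]

lemma hecke_of_gt {f : P → ℤ[X]} {u : P} (hu : u ∈ D) (h : u < M u) :
    hecke D x M f u = (X - 1) * f u + X * f (M u) := by
  simp [hecke, hu, h.not_gt, h.ne']

lemma hecke_of_notMem {f : P → ℤ[X]} {u : P} (hu : u ∉ D) :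
    hecke D x M f u = X * f u := by
  simp [hecke, hu]

/-- The quadratic relation of the Hecke algebra. -/
lemma hecke_hecke (hM : IsLifting D M) (hx : x = X ∨ x = -1) (f : P → ℤ[X]) :
    hecke D x M (hecke D x M f) = (X - 1 : ℤ[X]) • hecke D x M f + (X : ℤ[X]) • f := by
  ext1 u
  simp only [Pi.add_apply, Pi.smul_apply, smul_eq_mul]
  by_cases hu : u ∈ D
  · rcases hM.tri hu with h | h | h
    · have h2 : M u < M (M u) := by rw [hM.inv hu]; exact h.lt
      rw [hecke_of_lt hu h.lt, hecke_of_gt (hM.mem hu) h2, hecke_of_lt hu h.lt, hM.inv hu]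
    · rw [hecke_of_eq hu h, hecke_of_eq hu h]
      rcases hx with rfl | rfl <;> ring
    · have h2 : M (M u) < M u := by rw [hM.inv hu]; exact h.lt
      rw [hecke_of_gt hu h.lt, hecke_of_lt (hM.mem hu) h2, hM.inv hu]
  · simp only [hecke_of_notMem hu]
    ring

lemma letter_hecke (k : ℕ) :
    letter (hecke D x M) (hecke D x N) k = hecke D x (letter M N k) := by
  unfold letter
  split_ifs <;> rfl

/-- The two alternating words of length `m` agree when evaluated at `u`. -/
def BraidAt (D : Set P) (x : ℤ[X]) (M N : P → P) (m : ℕ) (u : P) : Prop :=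
  ∀ f : P → ℤ[X], word (hecke D x M) (hecke D x N) m f u = word (hecke D x N) (hecke D x M) m f u

lemma BraidAt.symm {m : ℕ} {u : P} (h : BraidAt D x M N m u) : BraidAt D x N M m u :=
  fun f => (h f).symm

lemma BraidAt.map (hM : IsLifting D M) (hN : IsLifting D N) (hx : x = X ∨ x = -1) {m : ℕ} {u : P}
    (h : BraidAt D x M N m u) (hu : u ∈ D) (hlt : M u < u) : BraidAt D x M N m (M u) := by
  intro f
  rcases m with _ | k
  · rfl
  have h1 : word (hecke D x M) (hecke D x N) (k + 1) f (M u) =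
      (X - 1) * word (hecke D x M) (hecke D x N) (k + 1) f u +
        X * word (hecke D x N) (hecke D x M) k f u := by
    rw [← hecke_of_lt (x := x) (f := word (hecke D x M) (hecke D x N) (k + 1) f) hu hlt, word, Module.End.mul_apply, hecke_hecke hM hx]
    rfl
  have h2 : word (hecke D x N) (hecke D x M) (k + 1) f (M u) =
      (X - 1) * word (hecke D x N) (hecke D x M) (k + 1) f u +
        X * word (hecke D x N) (hecke D x M) k f u := by
    have h3 : word (hecke D x N) (hecke D x M) (k + 1) f (M u) =
        word (hecke D x M) (hecke D x N) (k + 2) f u := by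
      rw [← hecke_of_lt (x := x) (f := word (hecke D x N) (hecke D x M) (k + 1) f) hu hlt]
      rfl
    rw [h3, word_succ, Module.End.mul_apply, h, word_succ, Module.End.mul_apply,
      ← letter_swap, letter_hecke, hecke_hecke
        (forall_letter hN hM k : IsLifting D (letter N M k)) hx, map_add, map_smul, map_smul,
      Module.End.mul_apply]
    rfl
  rw [h1, h2, h]

lemma BraidAt.alt (hM : IsLifting D M) (hN : IsLifting D N) (hx : x = X ∨ x = -1) {m : ℕ} {u : P}
    (h : BraidAt D x M N m u) (hu : u ∈ D) {k : ℕ} (hk : Descends M N u k) :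
    BraidAt D x M N m (alt M N k u) := by
  induction k generalizing M N u with
  | zero => exact h
  | succ k ih =>
    have hlt : M u < u := hk 0 (by omega)
    exact (ih hN hM (h.map hM hN hx hu hlt).symm (hM.mem hu)
      (fun i hi => hk (i + 1) (by omega))).symm

lemma word_apply_of_descends (hM : IsLifting D M) (hN : IsLifting D N) {t : P} (ht : t ∈ D)
    {k : ℕ} (hk : Descends M N t k) (f : P → ℤ[X]) :
    word (hecke D x M) (hecke D x N) k f t = f (alt M N k t) := by
  induction k generalizing M N t with
  | zero => rfl
  | succ k ih =>
    have hlt : M t < t := hk 0 (by omega)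
    rw [word, Module.End.mul_apply, hecke_of_lt ht hlt]
    exact ih hN hM (hM.mem ht) (fun i hi => hk (i + 1) (by omega))

/-- If both words of length `n` evaluate at `t` to the same multiple of evaluation at the end of a
descending walk, then the words of length any multiple of `n` agree at `t`. -/
lemma braidAt_of_dvd (hM : IsLifting D M) (hN : IsLifting D N) (hx : x = X ∨ x = -1) {t : P}
    (ht : t ∈ D) {n l m : ℕ} {c : ℤ[X]} (hl : Descends M N t l)
    (h1 : ∀ f, word (hecke D x M) (hecke D x N) n f t = c * f (alt M N l t))
    (h2 : ∀ f, word (hecke D x N) (hecke D x M) n f t = c * f (alt M N l t)) (hnm : n ∣ m) :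
    BraidAt D x M N m t := by
  obtain ⟨k, rfl⟩ := hnm
  induction k with
  | zero => exact fun f => rfl
  | succ k ih =>
    have hd := ih.alt hM hN hx ht hl
    intro f
    rw [Nat.mul_succ, Nat.add_comm, word_add, word_add, Module.End.mul_apply,
      Module.End.mul_apply, h1, h2]
    congr 1
    unfold letter
    by_cases hn : Even n
    · simpa [hn, Nat.even_add_one] using hd f
    · simpa [hn, Nat.even_add_one] using (hd f).symm

lemma braidAt_of_fixed (hD : D.Finite) (hM : IsLifting D M) (hN : IsLifting D N)
    (hx : x = X ∨ x = -1) {m : ℕ} {t : P} (ht : t ∈ D) (htM : M t = t) (htN : N t ≤ t)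
    (hcoh : (∀ a ∈ orbitMN M N t, ∀ b ∈ orbitMN M N t, a ≤ b ∨ b ≤ a) →
      (orbitMN M N t).ncard ∣ m) : BraidAt D x M N m t := by
  obtain ⟨k, hk, hend⟩ := exists_chain hD hM hN ht htM htN
  rw [orbitMN_eq_chain hM hN ht htM hend, hk.ncard_chain] at hcoh
  refine (braidAt_of_dvd hN hM hx ht hk (c := X - 1 - x) (n := k + 1) ?_ ?_
    (hcoh hk.chain_total)).symm
  · intro f
    rw [word_succ, Module.End.mul_apply, word_apply_of_descends hN hM ht hk, letter_hecke,
      hecke_of_eq (alt_mem hN hM ht k) hend]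
  · intro f
    rw [word, Module.End.mul_apply, hecke_of_eq ht htM, word_apply_of_descends hN hM ht hk]

/-- Under the divisibility conditions of strict coherence, the two words of length `m` agree
everywhere on `D`. -/
lemma braidAt_of_coherent (hD : D.Finite) (hM : IsLifting D M) (hN : IsLifting D N)
    (hx : x = X ∨ x = -1) {m : ℕ}
    (hcoh : ∀ u ∈ D, (∀ n, IsDihedralIntervalOfRank (orbitMN M N u) n → n ∣ m) ∧
      ((∀ a ∈ orbitMN M N u, ∀ b ∈ orbitMN M N u, a ≤ b ∨ b ≤ a) →
        (orbitMN M N u).ncard ∣ m)) {u : P} (hu : u ∈ D) : BraidAt D x M N m u := by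
  by_contra hbad
  obtain ⟨t, ⟨ht, htbad⟩, hmax⟩ := (hD.subset (Set.sep_subset D
    (fun v => ¬ BraidAt D x M N m v))).exists_maximal ⟨u, hu, hbad⟩
  have hgood : ∀ v ∈ D, t < v → BraidAt D x M N m v := by
    intro v hv htv
    by_contra hvbad
    exact htv.not_ge (hmax ⟨hv, hvbad⟩ htv.le)
  apply htbad
  by_cases hupM : t < M t
  · have := (hgood _ (hM.mem ht) hupM).map hM hN hx (hM.mem ht) (by rwa [hM.inv ht])
    rwa [hM.inv ht] at this
  by_cases hupN : t < N t
  · have := (hgood _ (hN.mem ht) hupN).symm.map hN hM hx (hN.mem ht) (by rwa [hN.inv ht])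
    rw [hN.inv ht] at this
    exact this.symm
  have htM : M t ≤ t := by
    rcases hM.tri ht with h | h | h
    exacts [h.le, h.le, absurd h.lt hupM]
  have htN : N t ≤ t := by
    rcases hN.tri ht with h | h | h
    exacts [h.le, h.le, absurd h.lt hupN]
  rcases htM.eq_or_lt with heM | hltM
  · exact braidAt_of_fixed hD hM hN hx ht heM htN (hcoh t ht).2
  rcases htN.eq_or_lt with heN | hltN
  · refine (braidAt_of_fixed hD hN hM hx ht heN htM ?_).symm
    rw [orbitMN_comm]
    exact (hcoh t ht).2
  obtain ⟨n, hn, h, h', heq, hdM, hdN⟩ := exists_meet hD hM hN ht hltM hltN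
  refine braidAt_of_dvd hM hN hx ht h (c := 1) ?_ ?_
    ((hcoh t ht).1 n (isDihedralInterval_orbitMN hM hN ht hn h h' heq hdM hdN))
  · intro f
    rw [word_apply_of_descends hM hN ht h, one_mul]
  · intro f
    rw [word_apply_of_descends hN hM ht h', heq, one_mul]

end Operators

section Matchings

variable {P : Type*} [PartialOrder P] {w : P} {M N : P → P}

lemma reflTransGen_covBy_of_le (hw : (Set.Iic w).Finite) {a b : P} (hb : b ≤ w) (hab : a ≤ b) :
    Relation.ReflTransGen (fun c d => c ⋖ d ∧ c ≤ w ∧ d ≤ w) a b := by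
  classical
  have : Fintype (Set.Iic w) := hw.fintype
  let _ : LocallyFiniteOrder (Set.Iic w) := Fintype.toLocallyFiniteOrder
  have h : (⟨a, hab.trans hb⟩ : Set.Iic w) ≤ ⟨b, hb⟩ := hab
  rw [le_iff_reflTransGen_covBy] at h
  refine h.lift (fun c : Set.Iic w => (c : P)) fun c d hcd =>
    ⟨⟨hcd.1, fun e h1 h2 => ?_⟩, c.2, d.2⟩
  exact hcd.2 (c := ⟨e, h2.le.trans d.2⟩) h1 h2

lemma _root_.IsSPMof.map_le_or (hM : IsSPMof w M) (hw : (Set.Iic w).Finite) {a b : P}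
    (hb : b ≤ w) (hab : a ≤ b) : M a ≤ b ∨ M a ≤ M b := by
  suffices h : a ≤ b ∧ (M a ≤ b ∨ M a ≤ M b) from h.2
  have hchain := reflTransGen_covBy_of_le hw hb hab
  clear hab
  induction hchain using Relation.ReflTransGen.head_induction_on with
  | refl => exact ⟨le_rfl, Or.inr le_rfl⟩
  | @head c d hcd _ ih =>
    refine ⟨hcd.1.le.trans ih.1, ?_⟩
    by_cases he : M c = d
    · exact Or.inl (he.trans_le ih.1)
    · have hlt := hM.2.2.2.2 c d hcd.2.1 hcd.2.2 hcd.1 he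
      exact ih.2.imp hlt.le.trans hlt.le.trans

lemma _root_.IsSPMof.le_map_or (hM : IsSPMof w M) (hw : (Set.Iic w).Finite) {a b : P}
    (hb : b ≤ w) (hab : a ≤ b) : a ≤ M b ∨ M a ≤ M b := by
  suffices h : a ≤ b ∧ (a ≤ M b ∨ M a ≤ M b) from h.2
  have hchain := reflTransGen_covBy_of_le hw hb hab
  clear hab hb
  induction hchain with
  | refl => exact ⟨le_rfl, Or.inr le_rfl⟩
  | @tail c d _ hcd ih =>
    refine ⟨ih.1.trans hcd.1.le, ?_⟩
    by_cases he : M c = d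
    · left
      rw [← he, hM.2.1 c hcd.2.1]
      exact ih.1
    · have hlt := hM.2.2.2.2 c d hcd.2.1 hcd.2.2 hcd.1 he
      exact ih.2.imp (fun h => h.trans hlt.le) (fun h => h.trans hlt.le)

lemma _root_.IsSPMof.isLifting (hM : IsSPMof w M) (hw : (Set.Iic w).Finite) :
    IsLifting (Set.Iic w) M where
  mem ha := hM.1 _ ha
  inv ha := hM.2.1 _ ha
  tri ha := hM.2.2.2.1 _ ha
  map_le _ hb hab h := (hM.map_le_or hw hb hab).elim id (fun h1 => h1.trans h)
  le_map _ hb hab h := (hM.le_map_or hw hb hab).elim id h.trans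

lemma eq_hecke_of_calcAt {x : ℤ[X]} {R : P → P → ℤ[X]} (hM : IsLifting (Set.Iic w) M)
    (hR : ∀ u z, ¬ u ≤ z → R u z = 0) {z : P} (hz : z ≤ w) (hMz : M z ⋖ z)
    (h : CalcAt x R M z) :
    (fun u => R u z) = hecke (Set.Iic w) x M (fun u => R u (M z)) := by
  ext1 u
  by_cases huz : u ≤ z
  · have hu : u ∈ Set.Iic w := huz.trans hz
    obtain ⟨h1, h2, h3⟩ := h u huz
    rcases hM.tri hu with hc | hc | hc
    · rw [hecke_of_lt hu hc.lt, h1 hc]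
    · rw [hecke_of_eq hu hc, h3 hc]
    · rw [hecke_of_gt hu hc.lt, h2 hc]
  · have h0 : R u (M z) = 0 := hR _ _ fun hle => huz (hle.trans hMz.le)
    by_cases hu : u ∈ Set.Iic w
    · have h1 : R (M u) (M z) = 0 := hR _ _ fun hle => huz <| by
        have := hM.map_le (hM.mem hu) hz (hle.trans hMz.le) hMz.le
        rwa [hM.inv hu] at this
      rcases hM.tri hu with hc | hc | hc
      · rw [hecke_of_lt hu hc.lt, hR u z huz, h1]
      · rw [hecke_of_eq hu hc, hR u z huz, h0, mul_zero]
      · rw [hecke_of_gt hu hc.lt, hR u z huz, h0, h1, mul_zero, mul_zero, add_zero]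
    · rw [hecke_of_notMem hu, hR u z huz, h0, mul_zero]

lemma calcAt_of_eq_hecke {x : ℤ[X]} {R : P → P → ℤ[X]}
    (h : ∀ u ≤ w, R u w = hecke (Set.Iic w) x M (fun u => R u (M w)) u) : CalcAt x R M w := by
  intro u hu
  have huD : u ∈ Set.Iic w := hu
  refine ⟨fun hc => ?_, fun hc => ?_, fun hc => ?_⟩
  · rw [h u hu, hecke_of_lt huD hc.lt]
  · rw [h u hu, hecke_of_gt huD hc.lt]
  · rw [h u hu, hecke_of_eq huD hc]

lemma eq_word_of_descends {D : Set P} {x : ℤ[X]} {r : P → P → ℤ[X]} {z : P}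
    (hM : ∀ y ≤ z, M y < y → r y = hecke D x M (r (M y)))
    (hN : ∀ y ≤ z, N y < y → r y = hecke D x N (r (N y))) {k : ℕ} (hk : Descends M N z k) :
    r z = word (hecke D x M) (hecke D x N) k (r (alt M N k z)) := by
  induction k generalizing M N z with
  | zero => rfl
  | succ k ih =>
    have hlt : M z < z := hk 0 (by omega)
    rw [hM z le_rfl hlt, ih (fun y hy => hN y (hy.trans hlt.le))
      (fun y hy => hM y (hy.trans hlt.le)) (fun i hi => hk (i + 1) (by omega))]
    rfl

end Matchings

end SpecialMatching

open SpecialMatching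

/-- Let `(P, ℳ)` be a refined pircon, `x ∈ {q, -1}`, `R` its family of
Kazhdan–Lusztig `R^x`-polynomials, `w` non-minimal and `M ∈ SPM_w`.  If (a) for every
`z < w` with `M z ⋖ z` the restriction of `M` to `P_{≤ z}` calculates, and (b) there is
a strongly calculating `N ∈ SPM_w` strictly coherent with `M`, then `M` is strongly
calculating (in particular, taking `z = w`, `M` calculates). -/
theorem stmt11 {P : Type*} [PartialOrder P] (hP : IsPircon P)
    (ℳ : P → P → P) (hℳ : ∀ v : P, ¬ IsMin v → IsSPMof v (ℳ v))
    (x : Polynomial ℤ) (hx : x = X ∨ x = -1)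
    (R : P → P → Polynomial ℤ) (hR : IsKLFamily ℳ x R)
    (w : P) (hw : ¬ IsMin w) (M : P → P) (hM : IsSPMof w M)
    (ha : ∀ z, z < w → M z ⋖ z → CalcAt x R M z)
    (hb : ∃ N : P → P, IsSPMof w N ∧ StronglyCalc x R N w ∧ StrictlyCoherent M N w) :
    StronglyCalc x R M w := by
  obtain ⟨N, hN, hNcalc, hcoh⟩ := hb
  have hfin : (Set.Iic w).Finite := (hP w hw).1
  have hLM := hM.isLifting hfin
  have hLN := hN.isLifting hfin
  have hwD : w ∈ Set.Iic w := le_refl w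
  intro z hz hMz
  rcases hz.lt_or_eq with hlt | rfl
  · exact ha z hlt hMz
  obtain ⟨n, hn, h, h', heq, hdM, hdN⟩ := exists_meet hfin hLM hLN hwD hM.2.2.1.lt hN.2.2.1.lt
  have hbraid : ∀ u ≤ z, BraidAt (Set.Iic z) x M N n u := fun u hu =>
    braidAt_of_coherent hfin hLM hLN hx
      (hcoh n (isDihedralInterval_orbitMN hLM hLN hwD hn h h' heq hdM hdN)) hu
  obtain ⟨k, rfl⟩ : ∃ k, n = k + 1 := ⟨n - 1, by omega⟩
  have hrN : ∀ y ≤ z, N y < y →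
      (fun u => R u y) = hecke (Set.Iic z) x N (fun u => R u (N y)) := fun y hy hlt =>
    eq_hecke_of_calcAt hLN hR.2.1 hy (hLN.covBy hy hlt) (hNcalc y hy (hLN.covBy hy hlt))
  have hrM : ∀ y < z, M y < y →
      (fun u => R u y) = hecke (Set.Iic z) x M (fun u => R u (M y)) := fun y hy hlt =>
    eq_hecke_of_calcAt hLM hR.2.1 hy.le (hLM.covBy hy.le hlt) (ha y hy (hLM.covBy hy.le hlt))
  have hMw := eq_word_of_descends (r := fun y u => R u y) (M := N) (N := M) (z := M z) (k := k)
    (fun y hy => hrN y (hy.trans hM.2.2.1.le))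
    (fun y hy => hrM y (hy.trans_lt hM.2.2.1.lt)) (fun i hi => h (i + 1) (by omega))
  have hNw := eq_word_of_descends (r := fun y u => R u y) (M := M) (N := N) (z := N z) (k := k)
    (fun y hy => hrM y (hy.trans_lt hN.2.2.1.lt))
    (fun y hy => hrN y (hy.trans hN.2.2.1.le)) (fun i hi => h' (i + 1) (by omega))
  have hw' := hrN z le_rfl hN.2.2.1.lt
  refine calcAt_of_eq_hecke fun u hu => ?_
  rw [hMw, show R u z = _ from congrFun hw' u, hNw]
  have hends : alt N M k (M z) = alt M N k (N z) := heq
  rw [hends]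
  exact (hbraid u hu _).symm
end
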